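/- arXiv:1701.06540 — 2 statements merged into one kernel-verified Lean document; each statement's English description precedes it below -/
import Mathlib

section
/- A set B ⊂ ℝⁿ is a maximal lattice-free convex set if and only if one of the following holds: (i) B is a polyhedron of the form B = P + L where P is a polytope and L is a rational linear subspace, dim(B) = dim(P) + dim(L) = n, the interior of B contains no integral point, and there is an integral point in the relative interior of each facet of B; (ii) B is a hyperplane of ℝⁿ that is not rational, i.e., B = {x ∈ ℝⁿ : a·x = β} where a is not a scalar multiple of a vector with rational coordinates. -/
open scoped BigOperators Pointwise

noncomputable section

/-- Euclidean space `ℝⁿ`. -/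
abbrev E (n : ℕ) := EuclideanSpace ℝ (Fin n)

/-- Dot product on `ℝⁿ`. -/
def dot {n : ℕ} (x y : E n) : ℝ := ∑ i, x i * y i

/-- A point with integral coordinates. -/
def IsIntPt {n : ℕ} (x : E n) : Prop := ∀ i, ∃ m : ℤ, x i = (m : ℝ)

/-- A vector with rational coordinates. -/
def IsRatVec {n : ℕ} (x : E n) : Prop := ∀ i, ∃ q : ℚ, x i = (q : ℝ)

/-- `S` is the set of integral points of a rational polyhedron `{x | Ax ≤ b}`. -/
def IsIntPtsOfRatPolyhedron {n : ℕ} (S : Set (E n)) : Prop :=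
  ∃ (m : ℕ) (A : Fin m → E n) (b : Fin m → ℝ),
    (∀ i, IsRatVec (A i)) ∧ (∀ i, ∃ q : ℚ, b i = (q : ℝ)) ∧
    S = {x | IsIntPt x ∧ ∀ i, dot (A i) x ≤ b i}

/-- `dim S = n`: `S` contains `n+1` affinely independent points. -/
def FullDimSet {n : ℕ} (S : Set (E n)) : Prop :=
  ∃ p : Fin (n + 1) → E n, (∀ i, p i ∈ S) ∧ AffineIndependent ℝ p

/-- `B` is `S`-free: the interior of `B` contains no point of `S`. -/
def SFree {n : ℕ} (S B : Set (E n)) : Prop := ∀ x ∈ interior B, x ∉ S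

/-- `B` is a maximal `S`-free convex set. -/
def MaxSFree {n : ℕ} (S B : Set (E n)) : Prop :=
  Convex ℝ B ∧ SFree S B ∧
    ∀ C : Set (E n), Convex ℝ C → SFree S C → B ⊆ C → B = C

/-- `B` is lattice-free: no integral point in its interior. -/
def LatticeFree {n : ℕ} (B : Set (E n)) : Prop := ∀ x ∈ interior B, ¬ IsIntPt x

/-- `B` is a maximal lattice-free convex set. -/
def MaxLatticeFree {n : ℕ} (B : Set (E n)) : Prop :=
  Convex ℝ B ∧ LatticeFree B ∧
    ∀ C : Set (E n), Convex ℝ C → LatticeFree C → B ⊆ C → B = C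

/-- A polyhedron: finite intersection of closed half-spaces. -/
def IsPolyhedron {n : ℕ} (B : Set (E n)) : Prop :=
  ∃ (m : ℕ) (a : Fin m → E n) (c : Fin m → ℝ), B = {x | ∀ i, dot (a i) x ≤ c i}

/-- A polytope: convex hull of finitely many points. -/
def IsPolytope {n : ℕ} (P : Set (E n)) : Prop :=
  ∃ V : Finset (E n), P = convexHull ℝ (V : Set (E n))

/-- Dimension of a set: dimension of its affine hull. -/
def sdim {n : ℕ} (A : Set (E n)) : ℕ := Module.finrank ℝ (affineSpan ℝ A).direction

/-- `F` is a face of the convex set `B`. -/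
def IsFaceOf {n : ℕ} (F B : Set (E n)) : Prop :=
  F ⊆ B ∧ Convex ℝ F ∧ ∀ x ∈ B, ∀ y ∈ B, ∀ t : ℝ, 0 < t → t < 1 →
    t • x + (1 - t) • y ∈ F → x ∈ F ∧ y ∈ F

/-- `F` is a facet of `B`: a nonempty face of dimension `dim B - 1`. -/
def IsFacetOf {n : ℕ} (F B : Set (E n)) : Prop :=
  IsFaceOf F B ∧ F.Nonempty ∧ sdim F + 1 = sdim B

/-- Recession cone of `K`. -/
def recCone {n : ℕ} (K : Set (E n)) : Set (E n) :=
  {d | ∀ x ∈ K, ∀ t : ℝ, 0 ≤ t → x + t • d ∈ K}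

/-- Lineality space of `K`. -/
def linSpace {n : ℕ} (K : Set (E n)) : Set (E n) :=
  {d | d ∈ recCone K ∧ -d ∈ recCone K}

/-- The set of all finite nonnegative combinations of elements of `G`. -/
def conicHullOf {n : ℕ} (G : Set (E n)) : Set (E n) :=
  {x | ∃ (m : ℕ) (c : Fin m → ℝ) (v : Fin m → E n),
    (∀ i, 0 ≤ c i) ∧ (∀ i, v i ∈ G) ∧ x = ∑ i, c i • v i}

/-- A cone is rational if it is generated by vectors with rational coordinates. -/
def IsRationalCone {n : ℕ} (C : Set (E n)) : Prop :=
  ∃ G : Set (E n), (∀ v ∈ G, IsRatVec v) ∧ C = conicHullOf G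

/-- A linear subspace is rational if it is spanned by rational vectors. -/
def IsRationalSubspace {n : ℕ} (L : Submodule ℝ (E n)) : Prop :=
  ∃ G : Set (E n), (∀ v ∈ G, IsRatVec v) ∧ L = Submodule.span ℝ G

/-- The hyperplane `{x | a·x = β}` is a supporting hyperplane of `C`. -/
def IsSupportingHyperplane {n : ℕ} (a : E n) (β : ℝ) (C : Set (E n)) : Prop :=
  ((∀ x ∈ C, dot a x ≤ β) ∨ (∀ x ∈ C, β ≤ dot a x)) ∧
    ∃ x ∈ closure C, dot a x = β

/-- `ψ` is a valid function with respect to `f` and `S`. -/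
def ValidFn {n : ℕ} (S : Set (E n)) (f : E n) (ψ : E n → ℝ) : Prop :=
  ∀ s : (E n) →₀ ℝ, (∀ r, 0 ≤ s r) →
    (f + s.sum fun r c => c • r) ∈ S →
    1 ≤ s.sum fun r c => ψ r * c

/-- Sublinear: positively homogeneous and subadditive. -/
def Sublinear {n : ℕ} (ψ : E n → ℝ) : Prop :=
  (∀ t : ℝ, 0 ≤ t → ∀ r, ψ (t • r) = t * ψ r) ∧
  (∀ r r', ψ (r + r') ≤ ψ r + ψ r')

/-- Polar of `K`. -/
def polar {n : ℕ} (K : Set (E n)) : Set (E n) := {y | ∀ r ∈ K, dot y r ≤ 1}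

/-- `K̂ = {y ∈ K* | ∃ x ∈ K, x·y = 1}`. -/
def Khat {n : ℕ} (K : Set (E n)) : Set (E n) :=
  {y | y ∈ polar K ∧ ∃ x ∈ K, dot x y = 1}

/-- `ρ_K(r) = sup { y·r | y ∈ K̂ }`. -/
def rho {n : ℕ} (K : Set (E n)) (r : E n) : ℝ :=
  sSup ((fun y => dot y r) '' Khat K)


theorem dot_eq_inner {n : ℕ} (a x : E n) : dot a x = inner ℝ a x := by
  simp [dot, PiLp.inner_apply, mul_comm]

theorem IsIntPt.add {n : ℕ} {x y : E n} (hx : IsIntPt x) (hy : IsIntPt y) : IsIntPt (x + y) := by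
  intro i
  obtain ⟨a, ha⟩ := hx i
  obtain ⟨b, hb⟩ := hy i
  exact ⟨a + b, by simp [ha, hb]⟩

theorem IsIntPt.neg {n : ℕ} {x : E n} (hx : IsIntPt x) : IsIntPt (-x) := by
  intro i
  obtain ⟨a, ha⟩ := hx i
  exact ⟨-a, by simp [ha]⟩

theorem IsIntPt.sub {n : ℕ} {x y : E n} (hx : IsIntPt x) (hy : IsIntPt y) : IsIntPt (x - y) := by
  rw [sub_eq_add_neg]
  exact hx.add hy.neg

theorem IsIntPt.zsmul {n : ℕ} {x : E n} (hx : IsIntPt x) (m : ℤ) : IsIntPt ((m : ℝ) • x) := by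
  intro i
  obtain ⟨a, ha⟩ := hx i
  exact ⟨m * a, by simp [ha]⟩

/-- the interior points of a half space satisfy the inequality strictly -/
theorem inner_lt_of_mem_interior {n : ℕ} {a : E n} (ha : a ≠ 0) {c : ℝ} {S : Set (E n)}
    (hS : ∀ x ∈ S, inner ℝ a x ≤ c) {x : E n} (hx : x ∈ interior S) : inner ℝ a x < c := by
  have h1 : Filter.Tendsto (fun t : ℝ => x + t • a) (nhds 0) (nhds x) := by
    have : Continuous (fun t : ℝ => x + t • a) := by fun_prop
    simpa using this.tendsto 0
  have h2 : ∀ᶠ t in nhdsWithin (0:ℝ) (Set.Ioi 0), x + t • a ∈ S :=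
    (h1.eventually (mem_interior_iff_mem_nhds.mp hx)).filter_mono nhdsWithin_le_nhds
  obtain ⟨t, ht, ht0⟩ := (h2.and self_mem_nhdsWithin).exists
  have := hS _ ht
  rw [inner_add_right, inner_smul_right] at this
  have h3 : 0 < inner ℝ a a := real_inner_self_pos.mpr ha
  have : 0 < t * inner ℝ a a := mul_pos ht0 h3
  linarith

theorem dense_int_values {n : ℕ} (a : E n)
    (ha : ¬ ∃ (c : ℝ) (v : E n), IsRatVec v ∧ a = c • v) {s t : ℝ} (hst : s < t) :
    ∃ z : E n, IsIntPt z ∧ s < inner ℝ a z ∧ inner ℝ a z < t := by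
  let φ : (Fin n → ℤ) →+ ℝ :=
    { toFun := fun m => ∑ i, a i * (m i : ℝ)
      map_zero' := by simp
      map_add' := by intro x y; simp [mul_add, Finset.sum_add_distrib] }
  rcases AddSubgroup.dense_or_cyclic φ.range with h | ⟨g, hg⟩
  · obtain ⟨y, hy, h1, h2⟩ := h.exists_between hst
    obtain ⟨m, rfl⟩ := hy
    refine ⟨WithLp.toLp 2 (fun i => (m i : ℝ)), fun i => ⟨m i, rfl⟩, ?_, ?_⟩
    · rw [← dot_eq_inner]; exact h1
    · rw [← dot_eq_inner]; exact h2
  · exfalso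
    apply ha
    have : ∀ i, ∃ k : ℤ, a i = k * g := by
      intro i
      have h1 : φ (Pi.single i 1) ∈ φ.range := ⟨_, rfl⟩
      rw [hg, AddSubgroup.mem_closure_singleton] at h1
      obtain ⟨k, hk⟩ := h1
      refine ⟨k, ?_⟩
      have h2 : φ (Pi.single i 1) = a i := by
        change ∑ j, a j * ((Pi.single i 1 : Fin n → ℤ) j : ℝ) = a i
        rw [Finset.sum_eq_single i]
        · simp
        · intro j _ hj; simp [hj]
        · simp
      rw [← h2, ← hk]; simp
    choose k hk using this
    refine ⟨g, WithLp.toLp 2 (fun i => (k i : ℝ)), fun i => ⟨k i, by simp⟩, ?_⟩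
    ext i
    simp [hk i, mul_comm]

theorem hyper_max {n : ℕ} (a : E n) (β : ℝ) (ha0 : a ≠ 0)
    (ha : ¬ ∃ (c : ℝ) (v : E n), IsRatVec v ∧ a = c • v) :
    MaxLatticeFree {x : E n | dot a x = β} := by
  simp only [dot_eq_inner]
  refine ⟨?_, ?_, ?_⟩
  · intro x hx y hy s t hs ht hst
    simp only [Set.mem_ofPred_eq] at *
    rw [inner_add_right, inner_smul_right, inner_smul_right, hx, hy, ← add_mul, hst, one_mul]
  · intro x hx
    exfalso
    have h1 := inner_lt_of_mem_interior ha0 (c := β) (fun y hy => le_of_eq hy) hx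
    have h2 := interior_subset hx
    simp only [Set.mem_ofPred_eq] at h2
    linarith
  · intro C hC hCf hBC
    refine hBC.antisymm ?_
    intro x hx
    by_contra hne
    replace hne : inner ℝ a x - β ≠ 0 := sub_ne_zero.mpr hne
    set δ := inner ℝ a x - β with hδ
    -- open slab
    let V : Set (E n) := {y | 0 < (inner ℝ a y - β) / δ ∧ (inner ℝ a y - β) / δ < 1}
    have hVo : IsOpen V := by
      have hc : Continuous (fun y : E n => (inner ℝ a y - β) / δ) := by fun_prop
      exact (isOpen_lt continuous_const hc).inter (isOpen_lt hc continuous_const)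
    have hVC : V ⊆ C := by
      rintro y ⟨h1, h2⟩
      set t := (inner ℝ a y - β) / δ with ht
      have hy : inner ℝ a y = β + t * δ := by
        rw [ht]; field_simp; ring
      have h3 : (1 - t) ≠ 0 := by linarith
      have hmem : (1 - t)⁻¹ • (y - t • x) ∈ C := by
        apply hBC
        simp only [Set.mem_ofPred_eq]
        rw [inner_smul_right, inner_sub_right, inner_smul_right, hy]
        have : inner ℝ a x = β + δ := by rw [hδ]; ring
        rw [this]
        field_simp
        ring
      have := hC hmem hx (a := 1 - t) (b := t) (by linarith) h1.le (by ring)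
      rwa [smul_smul, mul_inv_cancel₀ h3, one_smul, sub_add_cancel] at this
    have hz : ∃ z ∈ V, IsIntPt z := by
      rcases lt_or_gt_of_ne hne with h | h
      · obtain ⟨z, hz, h1, h2⟩ := dense_int_values a ha (s := β + δ) (t := β) (by linarith)
        refine ⟨z, ⟨div_pos_of_neg_of_neg (by linarith) h, ?_⟩, hz⟩
        rw [div_lt_one_of_neg h]; linarith
      · obtain ⟨z, hz, h1, h2⟩ := dense_int_values a ha (s := β) (t := β + δ) (by linarith)
        refine ⟨z, ⟨div_pos (by linarith) h, ?_⟩, hz⟩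
        rw [div_lt_one h]; linarith
    obtain ⟨z, hzV, hz⟩ := hz
    exact hCf z (interior_maximal hVC hVo hzV) hz


theorem small_step {n : ℕ} {ι : Type*} [Finite ι] (a : ι → E n) (c : ι → ℝ) (S : ι → Prop)
    (q : E n) (h : ∀ j, S j → inner ℝ (a j) q < c j) (v : E n) :
    ∃ t : ℝ, 0 < t ∧ ∀ j, S j → inner ℝ (a j) (q + t • v) < c j := by
  have h1 : ∀ᶠ t in nhdsWithin (0:ℝ) (Set.Ioi 0), ∀ j, S j → inner ℝ (a j) (q + t • v) < c j := by
    rw [Filter.eventually_all]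
    intro j
    by_cases hj : S j
    · have hc : Continuous (fun t : ℝ => inner ℝ (a j) (q + t • v)) := by fun_prop
      have h2 : ∀ᶠ t in nhds (0:ℝ), inner ℝ (a j) (q + t • v) < c j :=
        hc.continuousAt.eventually_lt continuousAt_const (by simpa using h j hj)
      exact (h2.filter_mono nhdsWithin_le_nhds).mono (fun t ht _ => ht)
    · simp [hj]
  obtain ⟨t, ht, ht0⟩ := (h1.and self_mem_nhdsWithin).exists
  exact ⟨t, ht0, ht⟩

theorem mem_interior_of_strict {n : ℕ} {ι : Type*} [Finite ι] (a : ι → E n) (c : ι → ℝ)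
    (x : E n) (h : ∀ j, inner ℝ (a j) x < c j) :
    x ∈ interior {x : E n | ∀ j, inner ℝ (a j) x ≤ c j} := by
  rw [mem_interior_iff_mem_nhds]
  have : ∀ᶠ y in nhds x, ∀ j, inner ℝ (a j) y ≤ c j := by
    rw [Filter.eventually_all]
    intro j
    have hc : Continuous (fun y : E n => inner ℝ (a j) y) := by fun_prop
    exact (hc.continuousAt.eventually_lt continuousAt_const (h j)).mono (fun _ h => h.le)
  exact this

theorem convex_halfspaces {n : ℕ} {ι : Type*} (a : ι → E n) (c : ι → ℝ) :
    Convex ℝ {x : E n | ∀ j, inner ℝ (a j) x ≤ c j} := by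
  intro x hx y hy s t hs ht hst j
  have h1 := hx j
  have h2 := hy j
  rw [inner_add_right, inner_smul_right, inner_smul_right]
  calc s * inner ℝ (a j) x + t * inner ℝ (a j) y ≤ s * c j + t * c j := by gcongr
    _ = c j := by rw [← add_mul, hst, one_mul]

theorem direction_eq {n : ℕ} (V : Submodule ℝ (E n)) (F : Set (E n)) (q : E n) (hq : q ∈ F)
    (h1 : ∀ x ∈ F, x - q ∈ V) (h2 : ∀ v ∈ V, ∃ t : ℝ, 0 < t ∧ q + t • v ∈ F) :
    (affineSpan ℝ F).direction = V := by
  rw [direction_affineSpan, vectorSpan_eq_span_vsub_set_right ℝ hq]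
  apply le_antisymm
  · rw [Submodule.span_le]
    rintro _ ⟨x, hx, rfl⟩
    exact h1 x hx
  · intro v hv
    obtain ⟨t, ht, hm⟩ := h2 v hv
    have h3 : t • v ∈ Submodule.span ℝ ((fun x => x -ᵥ q) '' F) := by
      apply Submodule.subset_span
      exact ⟨_, hm, by simp⟩
    have := Submodule.smul_mem _ t⁻¹ h3
    rwa [smul_smul, inv_mul_cancel₀ ht.ne', one_smul] at this

theorem relint_extend {n : ℕ} {F : Set (E n)} {z q : E n} (hz : z ∈ intrinsicInterior ℝ F)
    (hq : q ∈ affineSpan ℝ F) : ∃ t : ℝ, 0 < t ∧ z + t • (z - q) ∈ F := by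
  obtain ⟨z', hz', rfl⟩ := hz
  have hmem : ∀ t : ℝ, (z' : E n) + t • ((z' : E n) - q) ∈ affineSpan ℝ F := by
    intro t
    have h1 : (z' : E n) - q ∈ (affineSpan ℝ F).direction :=
      AffineSubspace.vsub_mem_direction z'.2 hq
    have := AffineSubspace.vadd_mem_of_mem_direction (Submodule.smul_mem _ t h1) z'.2
    rwa [vadd_eq_add, add_comm] at this
  let g : ℝ → affineSpan ℝ F := fun t => ⟨_, hmem t⟩
  have hg : Continuous g := by
    apply Continuous.subtype_mk
    fun_prop
  have h0 : g 0 = z' := by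
    apply Subtype.ext; simp [g]
  have h1 : ∀ᶠ t in nhds (0:ℝ), g t ∈ ((↑) ⁻¹' F : Set (affineSpan ℝ F)) := by
    apply hg.continuousAt.eventually
    rw [h0]
    exact mem_interior_iff_mem_nhds.mp hz'
  obtain ⟨t, ht, ht0⟩ := ((h1.filter_mono nhdsWithin_le_nhds).and
    (self_mem_nhdsWithin (s := Set.Ioi (0:ℝ)))).exists
  exact ⟨t, ht0, ht⟩

theorem finrank_ker_inner {n : ℕ} {a : E n} (ha : a ≠ 0) :
    Module.finrank ℝ (Submodule.span ℝ {a})ᗮ + 1 = n := by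
  have h := Submodule.finrank_add_finrank_orthogonal (Submodule.span ℝ {a})
  rw [finrank_span_singleton ha, finrank_euclideanSpace, Fintype.card_fin] at h
  omega

theorem irredundant {n : ℕ} {B : Set (E n)} (hB : IsPolyhedron B) :
    ∃ (m : ℕ) (a : Fin m → E n) (c : Fin m → ℝ), B = {x | ∀ i, inner ℝ (a i) x ≤ c i} ∧
      ∀ i, ∃ w, (∀ j, j ≠ i → inner ℝ (a j) w ≤ c j) ∧ c i < inner ℝ (a i) w := by
  classical
  simp only [IsPolyhedron, dot_eq_inner] at hB
  obtain ⟨a, c, hac⟩ := Nat.find_spec hB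
  have hmin := fun m => Nat.find_min (H := hB) (m := m)
  revert a c
  generalize Nat.find hB = m at hmin
  intro a c hac
  refine ⟨m, a, c, hac, ?_⟩
  intro i
  by_contra hcon
  push Not at hcon
  obtain ⟨m', rfl⟩ : ∃ m', m = m' + 1 := ⟨m - 1, by have := i.2; omega⟩
  refine hmin m' (Nat.lt_succ_self _) ⟨fun j => a (i.succAbove j), fun j => c (i.succAbove j), ?_⟩
  rw [hac]
  ext x
  simp only [Set.mem_ofPred_eq]
  constructor
  · intro h j; exact h _
  · intro h
    have h1 : ∀ j, j ≠ i → inner ℝ (a j) x ≤ c j := by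
      intro j hj
      obtain ⟨k, rfl⟩ := Fin.exists_succAbove_eq hj
      exact h k
    intro j
    by_cases hj : j = i
    · subst hj; exact hcon x h1
    · exact h1 j hj

theorem affineSpan_top_of_sdim {n : ℕ} {B : Set (E n)} (hne : B.Nonempty) (h : sdim B = n) :
    affineSpan ℝ B = ⊤ := by
  rw [← AffineSubspace.direction_eq_top_iff_of_nonempty ((affineSpan_nonempty ℝ).2 hne)]
  apply Submodule.eq_top_of_finrank_eq
  rw [finrank_euclideanSpace, Fintype.card_fin]
  exact h

theorem poly_max {n : ℕ} (B : Set (E n)) (hP : IsPolyhedron B) (hdim : sdim B = n)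
    (hlf : LatticeFree B)
    (hfac : ∀ F, IsFacetOf F B → ∃ z ∈ intrinsicInterior ℝ F, IsIntPt z) :
    MaxLatticeFree B := by
  obtain ⟨m, a, c, hB, hirr⟩ := irredundant hP
  have hconv : Convex ℝ B := by rw [hB]; exact convex_halfspaces a c
  refine ⟨hconv, hlf, ?_⟩
  intro C hC hCf hBC
  rcases B.eq_empty_or_nonempty with hemp | hne
  · have hn : n = 0 := by
      rw [← hdim, hemp]
      simp [sdim]
    subst hn
    rw [hemp]
    symm
    rw [Set.eq_empty_iff_forall_notMem]
    intro x hx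
    have : C = Set.univ := Set.eq_univ_of_forall (fun y => by rwa [Subsingleton.elim y x])
    exact hCf x (by rw [this]; simp) (fun i => i.elim0)
  have hInter : (interior B).Nonempty :=
    hconv.interior_nonempty_iff_affineSpan_eq_top.mpr (affineSpan_top_of_sdim hne hdim)
  obtain ⟨p, hp⟩ := hInter
  have hmB : ∀ x, x ∈ B ↔ ∀ i, inner ℝ (a i) x ≤ c i := by intro x; rw [hB]; rfl
  have ha : ∀ i, a i ≠ 0 := by
    intro i hi
    obtain ⟨w, -, hw⟩ := hirr i
    have := (hmB p).1 (interior_subset hp) i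
    rw [hi, inner_zero_left] at *
    linarith
  have hps : ∀ i, inner ℝ (a i) p < c i := fun i =>
    inner_lt_of_mem_interior (ha i) (fun x hx => (hmB x).1 hx i) hp
  refine hBC.antisymm ?_
  intro x hx
  by_contra hxB
  rw [hmB] at hxB
  push Not at hxB
  obtain ⟨i, hi⟩ := hxB
  obtain ⟨w, hw1, hw2⟩ := hirr i
  -- the crossing point
  obtain ⟨q, hq1, hq2⟩ : ∃ q, inner ℝ (a i) q = c i ∧ ∀ j, j ≠ i → inner ℝ (a j) q < c j := by
    have hd : 0 < inner ℝ (a i) w - inner ℝ (a i) p := by linarith [hps i]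
    set s := (c i - inner ℝ (a i) p) / (inner ℝ (a i) w - inner ℝ (a i) p) with hs
    have hs0 : 0 < s := div_pos (by linarith [hps i]) hd
    have hs1 : s < 1 := by rw [hs, div_lt_one hd]; linarith
    refine ⟨(1 - s) • p + s • w, ?_, ?_⟩
    · rw [inner_add_right, inner_smul_right, inner_smul_right]
      have : s * (inner ℝ (a i) w - inner ℝ (a i) p) = c i - inner ℝ (a i) p := by
        rw [hs]; field_simp
      linarith
    · intro j hj
      rw [inner_add_right, inner_smul_right, inner_smul_right]
      have h1 := hps j
      have h2 := hw1 j hj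
      nlinarith
  let F : Set (E n) := {y | y ∈ B ∧ inner ℝ (a i) y = c i}
  have hqF : q ∈ F := by
    refine ⟨(hmB q).2 fun j => ?_, hq1⟩
    by_cases hj : j = i
    · subst hj; exact hq1.le
    · exact (hq2 j hj).le
  have hdir : (affineSpan ℝ F).direction = (Submodule.span ℝ {a i})ᗮ := by
    apply direction_eq _ F q hqF
    · intro y hy
      rw [Submodule.mem_orthogonal_singleton_iff_inner_right, inner_sub_right, hy.2, hq1, sub_self]
    · intro v hv
      rw [Submodule.mem_orthogonal_singleton_iff_inner_right] at hv
      obtain ⟨t, ht, hts⟩ := small_step a c (fun j => j ≠ i) q hq2 v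
      have h1 : inner ℝ (a i) (q + t • v) = c i := by
        rw [inner_add_right, inner_smul_right, hv, mul_zero, add_zero, hq1]
      refine ⟨t, ht, (hmB _).2 fun j => ?_, h1⟩
      by_cases hj : j = i
      · subst hj; exact h1.le
      · exact (hts j hj).le
  have hF : IsFacetOf F B := by
    refine ⟨⟨fun y hy => hy.1, ?_, ?_⟩, ⟨q, hqF⟩, ?_⟩
    · intro y hy y' hy' s t hs ht hst
      refine ⟨hconv hy.1 hy'.1 hs ht hst, ?_⟩
      rw [inner_add_right, inner_smul_right, inner_smul_right, hy.2, hy'.2, ← add_mul, hst, one_mul]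
    · intro y hy y' hy' t ht0 ht1 hm
      have h1 := (hmB y).1 hy i
      have h2 := (hmB y').1 hy' i
      have h3 := hm.2
      rw [inner_add_right, inner_smul_right, inner_smul_right] at h3
      refine ⟨⟨hy, ?_⟩, ⟨hy', ?_⟩⟩
      · apply le_antisymm h1; nlinarith
      · apply le_antisymm h2; nlinarith
    · rw [hdim, sdim, hdir]
      exact finrank_ker_inner (ha i)
  obtain ⟨z, hz, hzi⟩ := hfac F hF
  have hzF : z ∈ F := intrinsicInterior_subset hz
  obtain ⟨ε, hε, hεm⟩ := relint_extend hz (subset_affineSpan ℝ F hqF)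
  have hzs : ∀ j, j ≠ i → inner ℝ (a j) z < c j := by
    intro j hj
    have h1 := (hmB _).1 hεm.1 j
    have h2 := hq2 j hj
    rw [inner_add_right, inner_smul_right, inner_sub_right] at h1
    nlinarith
  obtain ⟨t, ht, hts⟩ := small_step a c (fun j => j ≠ i) z hzs (z - x)
  have hu : z + t • (z - x) ∈ interior C := by
    apply interior_mono hBC
    rw [hB]
    apply mem_interior_of_strict
    intro j
    by_cases hj : j = i
    · subst hj
      rw [inner_add_right, inner_smul_right, inner_sub_right, hzF.2]
      nlinarith
    · exact hts j hj
  have hzC := hC.combo_interior_self_mem_interior hu hx (a := 1 / (1 + t)) (b := t / (1 + t))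
    (by positivity) (by positivity) (by field_simp)
  apply hCf z _ hzi
  convert hzC using 1
  have h1 : (1 + t) ≠ 0 := by positivity
  have h2 : (1 / (1 + t)) • (z + t • (z - x)) + (t / (1 + t)) • x
      = ((1 + t) / (1 + t)) • z := by
    simp only [div_eq_inv_mul, smul_add, smul_sub, smul_smul, mul_add, mul_one, add_smul]
    abel
  rw [h2, div_self h1, one_smul]


theorem exists_hyperplane {n : ℕ} (hn : 0 < n) {B : Set (E n)} (hconv : Convex ℝ B)
    (hInter : interior B = ∅) : ∃ (a : E n) (β : ℝ), a ≠ 0 ∧ B ⊆ {x | inner ℝ a x = β} := by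
  rcases B.eq_empty_or_nonempty with hemp | ⟨p, hp⟩
  · have : Nontrivial (E n) := by
      have : Nonempty (Fin n) := ⟨⟨0, hn⟩⟩
      infer_instance
    obtain ⟨a, ha⟩ := exists_ne (0 : E n)
    exact ⟨a, 0, ha, by simp [hemp]⟩
  · have h1 : affineSpan ℝ B ≠ ⊤ := by
      intro h
      rw [← hconv.interior_nonempty_iff_affineSpan_eq_top, hInter] at h
      exact Set.not_nonempty_empty h
    have h2 : (affineSpan ℝ B).direction ≠ ⊤ := by
      intro h
      rw [AffineSubspace.direction_eq_top_iff_of_nonempty ((affineSpan_nonempty ℝ).2 ⟨p, hp⟩)] at h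
      exact h1 h
    have h3 : (affineSpan ℝ B).directionᗮ ≠ ⊥ := by
      intro h
      exact h2 ((Submodule.orthogonal_eq_bot_iff).mp h)
    obtain ⟨a, ha, ha0⟩ := Submodule.exists_mem_ne_zero_of_ne_bot h3
    refine ⟨a, inner ℝ a p, ha0, ?_⟩
    intro x hx
    have h4 : x - p ∈ (affineSpan ℝ B).direction :=
      AffineSubspace.vsub_mem_direction (subset_affineSpan ℝ B hx) (subset_affineSpan ℝ B hp)
    have h5 := Submodule.inner_left_of_mem_orthogonal h4 ha
    rw [inner_sub_right] at h5
    simp only [Set.mem_ofPred_eq]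
    linarith

theorem rat_to_int {n : ℕ} {v : E n} (hv : IsRatVec v) :
    ∃ (N : ℝ) (w : E n), N ≠ 0 ∧ IsIntPt w ∧ w = N • v := by
  choose q hq using hv
  let N : ℕ := ∏ i, (q i).den
  have hN : N ≠ 0 := Finset.prod_ne_zero_iff.mpr (fun i _ => (q i).den_nz)
  refine ⟨N, (N : ℝ) • v, by exact_mod_cast hN, ?_, rfl⟩
  intro i
  obtain ⟨k, hk⟩ : (q i).den ∣ N := Finset.dvd_prod_of_mem _ (Finset.mem_univ i)
  refine ⟨k * (q i).num, ?_⟩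
  have h1 : (q i : ℝ) * ((q i).den : ℝ) = ((q i).num : ℝ) := by
    exact_mod_cast Rat.mul_den_eq_num (q i)
  simp only [PiLp.smul_apply, smul_eq_mul, hq i, hk]
  push_cast
  rw [← h1]
  ring

theorem inner_int {n : ℕ} {w z : E n} (hw : IsIntPt w) (hz : IsIntPt z) :
    ∃ k : ℤ, inner ℝ w z = k := by
  choose f hf using hw
  choose g hg using hz
  refine ⟨∑ i, f i * g i, ?_⟩
  rw [← dot_eq_inner, dot]
  push_cast
  exact Finset.sum_congr rfl (fun i _ => by rw [hf, hg])

theorem empty_interior_case {n : ℕ} (hn : 0 < n) {B : Set (E n)} (hB : MaxLatticeFree B)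
    (hInter : interior B = ∅) : ∃ (a : E n) (β : ℝ), a ≠ 0 ∧ B = {x | dot a x = β} ∧
        ¬ ∃ (c : ℝ) (v : E n), IsRatVec v ∧ a = c • v := by
  obtain ⟨hconv, -, hmax⟩ := hB
  obtain ⟨a, β, ha, hsub⟩ := exists_hyperplane hn hconv hInter
  simp only [dot_eq_inner]
  refine ⟨a, β, ha, ?_, ?_⟩
  · apply hmax _ _ _ hsub
    · intro x hx y hy s t hs ht hst
      simp only [Set.mem_ofPred_eq] at *
      rw [inner_add_right, inner_smul_right, inner_smul_right, hx, hy, ← add_mul, hst, one_mul]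
    · intro x hx
      exfalso
      have h1 := inner_lt_of_mem_interior ha (c := β) (fun y hy => le_of_eq hy) hx
      have h2 := interior_subset hx
      simp only [Set.mem_ofPred_eq] at h2
      linarith
  · rintro ⟨c, v, hv, hac⟩
    obtain ⟨N, w, hN, hw, hwv⟩ := rat_to_int hv
    have hc : c ≠ 0 := by
      rintro rfl; simp at hac; exact ha hac
    have hv0 : v ≠ 0 := by
      rintro rfl; simp at hac; exact ha hac
    have hw0 : w ≠ 0 := by
      rw [hwv]; exact smul_ne_zero hN hv0
    have haw : a = (c / N) • w := by
      rw [hwv, smul_smul, div_mul_cancel₀ _ hN, hac]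
    set γ := β / (c / N) with hγ
    have hcN : c / N ≠ 0 := div_ne_zero hc hN
    have hBw : ∀ x ∈ B, inner ℝ w x = γ := by
      intro x hx
      have := hsub hx
      simp only [Set.mem_ofPred_eq] at this
      rw [haw, real_inner_smul_left] at this
      rw [hγ, ← this]
      field_simp
    set k := ⌊γ⌋ with hk
    let S : Set (E n) := {x | ∀ j : Bool, inner ℝ (if j then w else -w) x ≤ (if j then (k + 1 : ℝ) else -(k : ℝ))}
    have hS1 : ∀ x ∈ S, inner ℝ w x ≤ k + 1 := fun x hx => by simpa using hx true
    have hS2 : ∀ x ∈ S, inner ℝ (-w) x ≤ -k := fun x hx => by simpa using hx false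
    have hSmem : ∀ x, inner ℝ w x ≤ k + 1 → (k : ℝ) ≤ inner ℝ w x → x ∈ S := by
      intro x h1 h2 j
      cases j
      · simpa using h2
      · simpa using h1
    have hBS : B = S := by
      apply hmax
      · exact convex_halfspaces _ _
      · intro x hx hxi
        have h1 := inner_lt_of_mem_interior hw0 hS1 hx
        have h2 := inner_lt_of_mem_interior (neg_ne_zero.mpr hw0) hS2 hx
        rw [inner_neg_left] at h2
        obtain ⟨l, hl⟩ := inner_int hw hxi
        rw [hl] at h1 h2
        have h3 : l < k + 1 := by exact_mod_cast h1
        have h4 : k < l := by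
          have : (k : ℝ) < l := by linarith
          exact_mod_cast this
        omega
      · intro x hx
        have := hBw x hx
        apply hSmem
        · rw [this]; exact (Int.lt_floor_add_one γ).le
        · rw [this]; exact Int.floor_le γ
    have hww : inner ℝ w w ≠ 0 := (real_inner_self_pos.mpr hw0).ne'
    have key : ∀ s : ℝ, inner ℝ w ((s / inner ℝ w w) • w) = s := by
      intro s
      rw [inner_smul_right, div_mul_cancel₀ _ hww]
    have h1 := hBw ((((k:ℝ)) / inner ℝ w w) • w) (by
      rw [hBS]; apply hSmem <;> rw [key]; linarith)
    have h2 := hBw ((((k:ℝ) + 1) / inner ℝ w w) • w) (by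
      rw [hBS]; apply hSmem <;> rw [key]; linarith)
    rw [key] at h1 h2
    linarith


structure MaxOpen {n : ℕ} (U : Set (E n)) : Prop where
  isOpen : IsOpen U
  convex : Convex ℝ U
  nonempty : U.Nonempty
  free : ∀ x ∈ U, ¬ IsIntPt x
  max : ∀ C : Set (E n), IsOpen C → Convex ℝ C → (∀ x ∈ C, ¬ IsIntPt x) → U ⊆ C → C ⊆ U

def Lin {n : ℕ} (U : Set (E n)) : Submodule ℝ (E n) where
  carrier := {d | ∀ x ∈ U, ∀ t : ℝ, x + t • d ∈ U}
  zero_mem' := by intro x hx t; simpa using hx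
  add_mem' := by
    intro d e hd he x hx t
    rw [smul_add, ← add_assoc]
    exact he _ (hd x hx t) t
  smul_mem' := by
    intro c d hd x hx t
    rw [smul_smul]
    exact hd x hx _

theorem mem_Lin {n : ℕ} {U : Set (E n)} {d : E n} :
    d ∈ Lin U ↔ ∀ x ∈ U, ∀ t : ℝ, x + t • d ∈ U := Iff.rfl

theorem add_mem_of_Lin {n : ℕ} {U : Set (E n)} {d x : E n} (hd : d ∈ Lin U) (hx : x ∈ U) :
    x + d ∈ U := by
  simpa using hd x hx 1

theorem MaxOpen.mem_Lin_of {n : ℕ} {U : Set (E n)} (hU : MaxOpen U) {u : E n}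
    (h : ∀ x ∈ U, ∀ t : ℝ, ¬ IsIntPt (x + t • u)) : u ∈ Lin U := by
  have hsub : (U + ((Submodule.span ℝ {u} : Submodule ℝ (E n)) : Set (E n))) ⊆ U := by
    apply hU.max
    · exact hU.isOpen.add_right
    · exact hU.convex.add (Submodule.convex _)
    · rintro _ ⟨x, hx, y, hy, rfl⟩
      obtain ⟨t, rfl⟩ := Submodule.mem_span_singleton.mp hy
      exact h x hx t
    · intro x hx
      exact ⟨x, hx, 0, Submodule.zero_mem _, by simp⟩
  intro x hx t
  exact hsub ⟨x, hx, t • u, Submodule.smul_mem _ _ (Submodule.mem_span_singleton_self u), rfl⟩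

/-- Dirichlet: integral points arbitrarily near a half-line. -/
theorem dirichlet {n : ℕ} (r : E n) {ε : ℝ} (hε : 0 < ε) (M : ℝ) :
    ∃ (l : ℝ) (z : E n), M ≤ l ∧ 0 < l ∧ IsIntPt z ∧ ‖z - l • r‖ < ε := by
  obtain ⟨N, hN⟩ := exists_nat_ge (max M 1)
  have hN1 : (1:ℝ) ≤ N := le_trans (le_max_right _ _) hN
  have hNM : M ≤ N := le_trans (le_max_left _ _) hN
  let fl : ℕ → E n := fun k => WithLp.toLp 2 (fun i => (⌊(k : ℝ) * N * r i⌋ : ℝ))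
  let fr : ℕ → E n := fun k => ((k : ℝ) * N) • r - fl k
  have hbd : ∀ k, fr k ∈ (WithLp.ofLp ⁻¹' (Set.Icc (fun _ => 0) (fun _ => 1)) : Set (E n)) := by
    intro k
    refine ⟨fun i => ?_, fun i => ?_⟩
    · simp [fr, fl]
    · simpa [fr, fl] using (Int.fract_lt_one ((k : ℝ) * N * r i)).le
  have hcpt : IsCompact (WithLp.ofLp ⁻¹' (Set.Icc (fun _ => 0) (fun _ => 1)) : Set (E n)) := by
    have h := isCompact_Icc (a := fun _ : Fin n => (0:ℝ)) (b := fun _ => 1)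
    exact (PiLp.homeomorph 2 (fun _ : Fin n => ℝ)).isCompact_preimage.mpr h
  obtain ⟨x, -, φ, hφ, hlim⟩ := hcpt.tendsto_subseq hbd
  have hc := hlim.cauchySeq
  rw [Metric.cauchySeq_iff] at hc
  obtain ⟨K, hK⟩ := hc ε hε
  have h1 := hK (K+1) (by omega) K le_rfl
  have hlt : φ K < φ (K+1) := hφ (Nat.lt_succ_self K)
  have hge : (1:ℝ) ≤ (φ (K+1) : ℝ) - φ K := by
    have : φ K + 1 ≤ φ (K+1) := hlt
    have : ((φ K : ℝ) + 1) ≤ φ (K+1) := by exact_mod_cast this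
    linarith
  refine ⟨((φ (K+1) : ℝ) - φ K) * N, fl (φ (K+1)) - fl (φ K), ?_, ?_, ?_, ?_⟩
  · nlinarith
  · nlinarith
  · exact IsIntPt.sub (fun i => ⟨_, rfl⟩) (fun i => ⟨_, rfl⟩)
  · rw [dist_eq_norm] at h1
    rw [← norm_neg]
    have h5 : -(fl (φ (K+1)) - fl (φ K) - (((φ (K+1) : ℝ) - φ K) * N) • r)
        = fr (φ (K+1)) - fr (φ K) := by
      simp only [fr]
      module
    rw [h5]
    exact h1

theorem MaxOpen.mem_Lin_of_rec {n : ℕ} {U : Set (E n)} (hU : MaxOpen U) {r : E n}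
    (h : ∀ x ∈ U, ∀ t : ℝ, 0 ≤ t → x + t • r ∈ U) : r ∈ Lin U := by
  apply hU.mem_Lin_of
  intro x hx t hInter
  obtain ⟨ε, hε, hball⟩ := Metric.isOpen_iff.mp hU.isOpen x hx
  obtain ⟨l, z, hl, -, hz, hd⟩ := dirichlet r hε (-t)
  have h1 : x + (z - l • r) ∈ U := by
    apply hball
    rw [mem_ball_iff_norm, add_sub_cancel_left]
    exact hd
  have h2 := h _ h1 (t + l) (by linarith)
  apply hU.free _ h2
  have h3 : x + (z - l • r) + (t + l) • r = (x + t • r) + z := by module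
  rw [h3]
  exact hInter.add hz

/-- projection on the orthogonal complement of the lineality space -/
def prj {n : ℕ} (U : Set (E n)) : E n →L[ℝ] E n := (Lin U)ᗮ.starProjection

theorem prj_mem {n : ℕ} (U : Set (E n)) (x : E n) : prj U x ∈ (Lin U)ᗮ :=
  Submodule.starProjection_apply_mem _ x

theorem sub_prj_mem {n : ℕ} (U : Set (E n)) (x : E n) : x - prj U x ∈ Lin U := by
  have := Submodule.sub_starProjection_mem_orthogonal (K := (Lin U)ᗮ) x
  rwa [Submodule.orthogonal_orthogonal] at this

theorem prj_eq_zero_iff {n : ℕ} (U : Set (E n)) (x : E n) : prj U x = 0 ↔ x ∈ Lin U := by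
  rw [prj, Submodule.starProjection_apply_eq_zero_iff, Submodule.orthogonal_orthogonal]

theorem mem_iff_of_sub_mem {n : ℕ} {U : Set (E n)} {x y : E n} (h : x - y ∈ Lin U) :
    x ∈ U ↔ y ∈ U := by
  constructor
  · intro hx
    have := add_mem_of_Lin ((Lin U).neg_mem h) hx
    simpa using this
  · intro hy
    have := add_mem_of_Lin h hy
    simpa using this

theorem MaxOpen.separated {n : ℕ} {U : Set (E n)} (hU : MaxOpen U) :
    ∃ ε : ℝ, 0 < ε ∧ ∀ z, IsIntPt z → ‖prj U z‖ < ε → z ∈ Lin U := by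
  by_contra hcon
  push Not at hcon
  have hseq : ∀ k : ℕ, ∃ z, IsIntPt z ∧ ‖prj U z‖ < 1 / ((k:ℝ) + 1) ∧ z ∉ Lin U :=
    fun k => hcon _ (by positivity)
  choose z hz hzn hzL using hseq
  have hw0 : ∀ k, 0 < ‖prj U (z k)‖ := by
    intro k
    rw [norm_pos_iff]
    intro h
    exact hzL k ((prj_eq_zero_iff U _).1 h)
  let d : ℕ → E n := fun k => (‖prj U (z k)‖)⁻¹ • prj U (z k)
  have hd : ∀ k, d k ∈ Metric.sphere (0 : E n) 1 := by
    intro k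
    rw [mem_sphere_zero_iff_norm, norm_smul, norm_inv, norm_norm, inv_mul_cancel₀ (hw0 k).ne']
  obtain ⟨u, hu, φ, hφ, hlim⟩ := (isCompact_sphere (0 : E n) 1).tendsto_subseq hd
  have huperp : u ∈ (Lin U)ᗮ := by
    have hcl : IsClosed (((Lin U)ᗮ : Submodule ℝ (E n)) : Set (E n)) := Submodule.isClosed_orthogonal _
    exact hcl.mem_of_tendsto hlim
      (Filter.Eventually.of_forall fun k => Submodule.smul_mem _ _ (prj_mem U _))
  have huL : u ∈ Lin U := by
    apply hU.mem_Lin_of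
    intro x hx t hInter
    -- integral multipliers
    let m : ℕ → ℤ := fun k => round (-t / ‖prj U (z (φ k))‖)
    have hm0 : Filter.Tendsto (fun k => ‖prj U (z (φ k))‖) Filter.atTop (nhds 0) := by
      have h1 : Filter.Tendsto (fun k : ℕ => 1 / ((k : ℝ) + 1)) Filter.atTop (nhds 0) :=
        tendsto_one_div_add_atTop_nhds_zero_nat
      have h2 := h1.comp hφ.tendsto_atTop
      exact squeeze_zero (fun k => norm_nonneg _) (fun k => (hzn (φ k)).le) h2
    have hm1 : Filter.Tendsto (fun k => (m k : ℝ) * ‖prj U (z (φ k))‖) Filter.atTop (nhds (-t)) := by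
      rw [tendsto_iff_norm_sub_tendsto_zero]
      refine squeeze_zero (fun k => norm_nonneg _) (fun k => ?_) hm0
      have h1 := abs_sub_round (-t / ‖prj U (z (φ k))‖)
      have h2 := hw0 (φ k)
      have h3 : (m k : ℝ) * ‖prj U (z (φ k))‖ - -t
          = -((-t / ‖prj U (z (φ k))‖ - round (-t / ‖prj U (z (φ k))‖)) * ‖prj U (z (φ k))‖) := by
        simp only [m]; field_simp; ring
      rw [h3, norm_neg, norm_mul, Real.norm_eq_abs, norm_norm]
      nlinarith
    have hm2 : Filter.Tendsto (fun k => (x + t • u) + (m k : ℝ) • prj U (z (φ k)))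
        Filter.atTop (nhds x) := by
      have h1 := (hm1.smul hlim).const_add (x + t • u)
      have h2 : x + t • u + (-t) • u = x := by module
      rw [h2] at h1
      refine h1.congr (fun k => ?_)
      simp only [d, Function.comp, smul_smul]
      rw [mul_assoc, mul_inv_cancel₀ (hw0 (φ k)).ne', mul_one]
    obtain ⟨k, hk⟩ := (hm2.eventually (hU.isOpen.mem_nhds hx)).exists
    have h4 : (x + t • u) + (m k : ℝ) • z (φ k) ∈ U := by
      rw [mem_iff_of_sub_mem (y := (x + t • u) + (m k : ℝ) • prj U (z (φ k)))]
      · exact hk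
      · have : (x + t • u) + (m k : ℝ) • z (φ k) - ((x + t • u) + (m k : ℝ) • prj U (z (φ k)))
          = (m k : ℝ) • (z (φ k) - prj U (z (φ k))) := by module
        rw [this]
        exact Submodule.smul_mem _ _ (sub_prj_mem U _)
    exact hU.free _ h4 (hInter.add ((hz _).zsmul _))
  have h0 : inner ℝ u u = 0 := Submodule.inner_right_of_mem_orthogonal huL huperp
  rw [inner_self_eq_zero] at h0
  rw [h0] at hu
  simp at hu

theorem IsIntPt.isRatVec {n : ℕ} {z : E n} (hz : IsIntPt z) : IsRatVec z := by
  intro i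
  obtain ⟨m, hm⟩ := hz i
  exact ⟨m, by simp [hm]⟩

theorem MaxOpen.rational {n : ℕ} {U : Set (E n)} (hU : MaxOpen U) :
    IsRationalSubspace (Lin U) := by
  refine ⟨{z | IsIntPt z ∧ z ∈ Lin U}, fun v hv => hv.1.isRatVec, ?_⟩
  apply le_antisymm
  · intro r hr
    obtain ⟨ε, hε, hsep⟩ := hU.separated
    have hcl : IsClosed ((Submodule.span ℝ {z : E n | IsIntPt z ∧ z ∈ Lin U} :
      Submodule ℝ (E n)) : Set (E n)) := Submodule.closed_of_finiteDimensional _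
    rw [← SetLike.mem_coe, ← hcl.closure_eq, Metric.mem_closure_iff]
    intro δ hδ
    obtain ⟨l, z, hl, hl0, hz, hd⟩ := dirichlet r hε (ε / δ)
    have hzL : z ∈ Lin U := by
      apply hsep z hz
      have h1 : prj U z = prj U (z - l • r) := by
        rw [map_sub, map_smul, (prj_eq_zero_iff U r).2 hr, smul_zero, sub_zero]
      rw [h1]
      exact lt_of_le_of_lt (Submodule.norm_starProjection_apply_le _ _) hd
    refine ⟨l⁻¹ • z, Submodule.smul_mem _ _ (Submodule.subset_span ⟨hz, hzL⟩), ?_⟩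
    rw [dist_comm, dist_eq_norm]
    have h2 : l⁻¹ • z - r = l⁻¹ • (z - l • r) := by
      rw [smul_sub, smul_smul, inv_mul_cancel₀ hl0.ne', one_smul]
    rw [h2, norm_smul, norm_inv, Real.norm_eq_abs, abs_of_pos hl0, inv_mul_lt_iff₀ hl0]
    rw [div_le_iff₀ hδ] at hl
    linarith
  · rw [Submodule.span_le]
    exact fun z hz => hz.2

theorem MaxOpen.bounded {n : ℕ} {U : Set (E n)} (hU : MaxOpen U) :
    Bornology.IsBounded (U ∩ ((Lin U)ᗮ : Submodule ℝ (E n))) := by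
  by_contra hcon
  rw [not_bounded_iff_exists_ne_zero_mem_asymptoticCone] at hcon
  obtain ⟨v, hv0, hv⟩ := hcon
  have hvU : v ∈ asymptoticCone ℝ U := asymptoticCone_mono Set.inter_subset_left hv
  have hvP : v ∈ (Lin U)ᗮ := by
    have h1 := asymptoticCone_mono Set.inter_subset_right hv
    rw [asymptoticCone_submodule,
      (Submodule.isClosed_orthogonal _).closure_eq] at h1
    exact h1
  have hvL : v ∈ Lin U := by
    apply hU.mem_Lin_of_rec
    intro x hx t ht
    have := hU.convex.smul_vadd_mem_of_mem_nhds_of_mem_asymptoticCone ht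
      (hU.isOpen.mem_nhds hx) hvU
    rwa [vadd_eq_add, add_comm] at this
  have h0 : inner ℝ v v = 0 := Submodule.inner_right_of_mem_orthogonal hvL hvP
  exact hv0 (inner_self_eq_zero.mp h0)

theorem MaxOpen.bound {n : ℕ} {U : Set (E n)} (hU : MaxOpen U) :
    ∃ M : ℝ, ∀ x ∈ U, ‖prj U x‖ ≤ M := by
  obtain ⟨M, hM⟩ := hU.bounded.exists_norm_le
  refine ⟨M, fun x hx => hM _ ⟨?_, prj_mem U x⟩⟩
  exact (mem_iff_of_sub_mem (sub_prj_mem U x)).1 hx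


theorem MaxOpen.finite_proj {n : ℕ} {U : Set (E n)} (hU : MaxOpen U) {K : Set (E n)}
    (hK : IsCompact K) : {p : E n | p ∈ K ∧ ∃ z, IsIntPt z ∧ prj U z = p}.Finite := by
  by_contra hinf
  have hinf : {p : E n | p ∈ K ∧ ∃ z, IsIntPt z ∧ prj U z = p}.Infinite := hinf
  obtain ⟨ε, hε, hsep⟩ := hU.separated
  let g := hinf.natEmbedding
  obtain ⟨x, -, φ, hφ, hlim⟩ := hK.tendsto_subseq (x := fun k => (g k : E n)) (fun k => (g k).2.1)
  have hc := hlim.cauchySeq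
  rw [Metric.cauchySeq_iff] at hc
  obtain ⟨N, hN⟩ := hc ε hε
  have h1 := hN (N+1) (by omega) N le_rfl
  simp only [Function.comp] at h1
  obtain ⟨z1, hz1, hp1⟩ := (g (φ (N+1))).2.2
  obtain ⟨z2, hz2, hp2⟩ := (g (φ N)).2.2
  have h2 : z1 - z2 ∈ Lin U := by
    apply hsep _ (hz1.sub hz2)
    rw [map_sub, hp1, hp2, ← dist_eq_norm]
    exact h1
  rw [← prj_eq_zero_iff, map_sub, hp1, hp2, sub_eq_zero] at h2
  have h3 := hφ.injective (g.injective (Subtype.ext h2))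
  omega

theorem perp_of_bdd {n : ℕ} {U : Set (E n)} (hne : U.Nonempty) {a : E n} {c : ℝ}
    (h : ∀ x ∈ U, inner ℝ a x ≤ c) {d : E n} (hd : d ∈ Lin U) : inner ℝ a d = 0 := by
  obtain ⟨p, hp⟩ := hne
  by_contra h0
  have := h _ (hd p hp ((c - inner ℝ a p + 1) / inner ℝ a d))
  rw [inner_add_right, inner_smul_right, div_mul_cancel₀ _ h0] at this
  linarith

theorem MaxOpen.finite_rep {n : ℕ} {U : Set (E n)} (hU : MaxOpen U) (a : E n → E n) (c : E n → ℝ)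
    (ha : ∀ y, IsIntPt y → a y ≠ 0) (hac : ∀ y, IsIntPt y → ∀ x ∈ U, inner ℝ (a y) x ≤ c y)
    (hy : ∀ y, IsIntPt y → c y ≤ inner ℝ (a y) y) :
    ∃ (ι : Type) (_ : Finite ι) (α : ι → E n) (γ : ι → ℝ),
      closure U = {x | ∀ j, inner ℝ (α j) x ≤ γ j} ∧
      ∀ j, (∃ y, IsIntPt y ∧ α j = a y ∧ γ j = c y) ∨ (∀ x ∈ closure U, inner ℝ (α j) x < γ j) := by
  obtain ⟨M, hM⟩ := hU.bound
  let K : Set (E n) := WithLp.ofLp ⁻¹' (Set.Icc (fun _ => -(M+1)) (fun _ => M+1))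
  have hK : IsCompact K := by
    have h := isCompact_Icc (a := fun _ : Fin n => -(M+1)) (b := fun _ => M+1)
    exact (PiLp.homeomorph 2 (fun _ : Fin n => ℝ)).isCompact_preimage.mpr h
  let T : Set (E n) := {p : E n | p ∈ K ∧ ∃ z, IsIntPt z ∧ prj U z = p}
  have hT : T.Finite := hU.finite_proj hK
  have hrep : ∀ p : T, ∃ z, IsIntPt z ∧ prj U z = p := fun p => p.2.2
  choose zf hzf hzp using hrep
  have hTf : Finite T := hT
  let e : Fin n → E n := fun i => EuclideanSpace.single i (1:ℝ)
  let α : (Fin n × Bool) ⊕ T → E n :=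
    Sum.elim (fun q => (if q.2 then (1:ℝ) else -1) • prj U (e q.1)) (fun p => a (zf p))
  let γ : (Fin n × Bool) ⊕ T → ℝ := Sum.elim (fun _ => M + 1) (fun p => c (zf p))
  have hin : ∀ i x, inner ℝ (prj U (e i)) x = (prj U x) i := by
    intro i x
    rw [prj, Submodule.inner_starProjection_left_eq_right]
    simp [e, EuclideanSpace.inner_single_left]
  have hbox : ∀ q x, x ∈ closure U → inner ℝ (α (Sum.inl q)) x < γ (Sum.inl q) := by
    intro q x hx
    have h1 : closure U ⊆ {x | inner ℝ (α (Sum.inl q)) x ≤ M} := by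
      apply closure_minimal
      · intro x hx
        have h2 := hM x hx
        have h3 := PiLp.norm_apply_le (prj U x) q.1
        rw [Real.norm_eq_abs] at h3
        have h4 := abs_le.mp (h3.trans h2)
        simp only [Set.mem_ofPred_eq, α, Sum.elim_inl, real_inner_smul_left, hin]
        split_ifs <;> linarith
      · exact isClosed_le (by fun_prop) (by fun_prop)
    have := h1 hx
    simp only [Set.mem_ofPred_eq] at this
    simp only [γ, Sum.elim_inl]
    linarith
  have hsub : closure U ⊆ {x | ∀ j, inner ℝ (α j) x ≤ γ j} := by
    intro x hx j
    rcases j with q | p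
    · exact (hbox q x hx).le
    · have h1 : closure U ⊆ {x | inner ℝ (a (zf p)) x ≤ c (zf p)} := by
        apply closure_minimal
        · exact hac _ (hzf p)
        · exact isClosed_le (by fun_prop) (by fun_prop)
      exact h1 hx
  refine ⟨_, inferInstance, α, γ, ?_, ?_⟩
  · apply hsub.antisymm
    have hQc : Convex ℝ {x | ∀ j, inner ℝ (α j) x ≤ γ j} := convex_halfspaces α γ
    have hUQ : U ⊆ interior {x | ∀ j, inner ℝ (α j) x ≤ γ j} :=
      interior_maximal (subset_closure.trans hsub) hU.isOpen
    have h1 : interior {x | ∀ j, inner ℝ (α j) x ≤ γ j} ⊆ U := by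
      apply hU.max _ isOpen_interior hQc.interior _ hUQ
      intro z hz hzi
      have hzQ := interior_subset hz
      have hpK : prj U z ∈ K := by
        refine ⟨fun i => ?_, fun i => ?_⟩
        · have := hzQ (Sum.inl (i, false))
          simp only [α, γ, Sum.elim_inl, real_inner_smul_left, hin] at this
          simp at this ⊢
          linarith
        · have := hzQ (Sum.inl (i, true))
          simp only [α, γ, Sum.elim_inl, real_inner_smul_left, hin] at this
          simpa using this
      let p : T := ⟨prj U z, hpK, z, hzi, rfl⟩
      have hd : z - zf p ∈ Lin U := by
        rw [← prj_eq_zero_iff, map_sub, hzp p, sub_self]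
      have h2 := perp_of_bdd hU.nonempty (hac _ (hzf p)) hd
      rw [inner_sub_right] at h2
      have h3 := hy _ (hzf p)
      have h4 := inner_lt_of_mem_interior (ha _ (hzf p)) (c := γ (Sum.inr p))
        (S := {x | ∀ j, inner ℝ (α j) x ≤ γ j}) (fun x hx => hx (Sum.inr p)) hz
      simp only [γ, Sum.elim_inr] at h4
      linarith
    calc {x | ∀ j, inner ℝ (α j) x ≤ γ j} ⊆ closure {x | ∀ j, inner ℝ (α j) x ≤ γ j} := subset_closure
      _ = closure (interior {x | ∀ j, inner ℝ (α j) x ≤ γ j}) :=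
        (hQc.closure_interior_eq_closure_of_nonempty_interior (hU.nonempty.mono hUQ)).symm
      _ ⊆ closure U := closure_mono h1
  · intro j
    rcases j with q | p
    · right; exact fun x hx => hbox q x hx
    · left; exact ⟨zf p, hzf p, rfl, rfl⟩

theorem MaxOpen.poly {n : ℕ} {U : Set (E n)} (hU : MaxOpen U) :
    ∃ (ι : Type) (_ : Finite ι) (α : ι → E n) (γ : ι → ℝ),
      closure U = {x | ∀ j, inner ℝ (α j) x ≤ γ j} := by
  have h : ∀ y : E n, ∃ (a : E n), IsIntPt y → a ≠ 0 ∧ (∀ x ∈ U, inner ℝ a x ≤ inner ℝ a y) := by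
    intro y
    by_cases hy : IsIntPt y
    · obtain ⟨f, hf⟩ := geometric_hahn_banach_open_point hU.convex hU.isOpen (fun h => hU.free y h hy)
      refine ⟨(InnerProductSpace.toDual ℝ (E n)).symm f, fun _ => ⟨?_, ?_⟩⟩
      · intro h0
        obtain ⟨p, hp⟩ := hU.nonempty
        have h1 := hf p hp
        have h2 : f = 0 := by simpa using h0
        rw [h2] at h1
        simp at h1
      · intro x hx
        rw [InnerProductSpace.toDual_symm_apply, InnerProductSpace.toDual_symm_apply]
        exact (hf x hx).le
    · exact ⟨0, fun h => absurd h hy⟩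
  choose a ha using h
  obtain ⟨ι, hι, α, γ, h, -⟩ := hU.finite_rep a (fun y => inner ℝ (a y) y)
    (fun y hy => (ha y hy).1) (fun y hy => (ha y hy).2) (fun y _ => le_rfl)
  exact ⟨ι, hι, α, γ, h⟩

theorem isPolyhedron_of_finite {n : ℕ} {ι : Type} [Finite ι] (α : ι → E n) (γ : ι → ℝ) :
    IsPolyhedron {x | ∀ j, inner ℝ (α j) x ≤ γ j} := by
  obtain ⟨m, ⟨e⟩⟩ := Finite.exists_equiv_fin ι
  refine ⟨m, fun i => α (e.symm i), fun i => γ (e.symm i), ?_⟩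
  ext x
  simp only [dot_eq_inner, Set.mem_ofPred_eq]
  constructor
  · intro h i; exact h _
  · intro h j
    simpa using h (e j)

theorem polytope_of {n : ℕ} {ι : Type} [Finite ι] (α : ι → E n) (γ : ι → ℝ)
    (V : Submodule ℝ (E n)) (P : Set (E n)) (hP : P = {x | ∀ j, inner ℝ (α j) x ≤ γ j} ∩ V)
    (hb : Bornology.IsBounded P) : IsPolytope P := by
  have hconv : Convex ℝ P := by
    rw [hP]; exact (convex_halfspaces α γ).inter V.convex
  have hclosed : IsClosed P := by
    rw [hP]
    apply IsClosed.inter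
    · have : {x : E n | ∀ j, inner ℝ (α j) x ≤ γ j} = ⋂ j, {x | inner ℝ (α j) x ≤ γ j} := by
        ext x; simp
      rw [this]
      exact isClosed_iInter fun j => isClosed_le (by fun_prop) (by fun_prop)
    · exact Submodule.closed_of_finiteDimensional V
  have hcpt : IsCompact P := Metric.isCompact_of_isClosed_isBounded hclosed hb
  have hfin : (P.extremePoints ℝ).Finite := by
    apply Set.Finite.of_injOn (f := fun x => {j | inner ℝ (α j) x < γ j}) (t := Set.univ)
      (fun _ _ => Set.mem_univ _) _ Set.finite_univ
    intro x hx y hy hxy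
    simp only [] at hxy
    have hxP := hx.1
    have hyP := hy.1
    rw [hP] at hxP hyP
    obtain ⟨t, ht, hts⟩ := small_step α γ (fun j => inner ℝ (α j) x < γ j) x (fun _ h => h) (x - y)
    have hm : x + t • (x - y) ∈ P := by
      rw [hP]
      refine ⟨fun j => ?_, V.add_mem hxP.2 (V.smul_mem _ (V.sub_mem hxP.2 hyP.2))⟩
      by_cases hj : inner ℝ (α j) x < γ j
      · exact (hts j hj).le
      · have hj' : ¬ inner ℝ (α j) y < γ j := by
          intro h
          have : j ∈ {j | inner ℝ (α j) y < γ j} := h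
          rw [← hxy] at this
          exact hj this
        have h1 := hxP.1 j
        have h2 := hyP.1 j
        rw [inner_add_right, inner_smul_right, inner_sub_right]
        have h3 : inner ℝ (α j) x = inner ℝ (α j) y := by linarith
        rw [h3, sub_self, mul_zero, add_zero]
        exact h2
    rw [mem_extremePoints] at hx
    have hseg : x ∈ openSegment ℝ y (x + t • (x - y)) := by
      refine ⟨t / (1 + t), 1 / (1 + t), by positivity, by positivity, by field_simp; ring, ?_⟩
      have h1 : (1 + t) ≠ 0 := by positivity
      have h2 : (t / (1 + t)) • y + (1 / (1 + t)) • (x + t • (x - y)) = ((1 + t) / (1 + t)) • x := by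
        simp only [div_eq_inv_mul, smul_add, smul_sub, smul_smul, mul_add, mul_one, add_smul]
        abel
      rw [h2, div_self h1, one_smul]
    exact (hx.2 y hy.1 _ hm hseg).1.symm
  refine ⟨hfin.toFinset, ?_⟩
  rw [Set.Finite.coe_toFinset]
  have h1 := closure_convexHull_extremePoints hcpt hconv
  rw [(hfin.isClosed_convexHull ℝ).closure_eq] at h1
  exact h1.symm


theorem face_seg {n : ℕ} {F B : Set (E n)} (hF : IsFaceOf F B) {p x : E n} (hp : p ∈ F)
    (hx : x ∈ B) {t : ℝ} (ht : 0 < t) (hm : p + t • (p - x) ∈ B) : x ∈ F := by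
  refine (hF.2.2 x hx _ hm (t / (1 + t)) (by positivity) ?_ ?_).1
  · rw [div_lt_one (by positivity)]; linarith
  · have h1 : (1 + t) ≠ 0 := by positivity
    have h0 : 1 - t / (1 + t) = 1 / (1 + t) := by field_simp; ring
    have h2 : (t / (1 + t)) • x + (1 - t / (1 + t)) • (p + t • (p - x)) = p := by
      have h3 : (t / (1 + t)) • x + (1 / (1 + t)) • (p + t • (p - x)) = ((1 + t) / (1 + t)) • p := by
        simp only [div_eq_inv_mul, smul_add, smul_sub, smul_smul, mul_add, mul_one, add_smul]
        abel
      rw [h0, h3, div_self h1, one_smul]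
    rw [h2]; exact hp

theorem exists_step_mem {n : ℕ} {U : Set (E n)} (hU : IsOpen U) {p : E n} (hp : p ∈ U) (v : E n) :
    ∃ t : ℝ, 0 < t ∧ p + t • v ∈ U := by
  have hc : Continuous (fun t : ℝ => p + t • v) := by fun_prop
  have h1 : ∀ᶠ t in nhds (0:ℝ), p + t • v ∈ U :=
    hc.continuousAt.eventually (hU.mem_nhds (by simpa using hp))
  obtain ⟨t, ht, ht0⟩ := ((h1.filter_mono nhdsWithin_le_nhds).and
    (self_mem_nhdsWithin (s := Set.Ioi (0:ℝ)))).exists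
  exact ⟨t, ht0, ht⟩

theorem direction_le {n : ℕ} (V : Submodule ℝ (E n)) (F : Set (E n)) (q : E n) (hq : q ∈ F)
    (h1 : ∀ x ∈ F, x - q ∈ V) : (affineSpan ℝ F).direction ≤ V := by
  rw [direction_affineSpan, vectorSpan_eq_span_vsub_set_right ℝ hq, Submodule.span_le]
  rintro _ ⟨x, hx, rfl⟩
  exact h1 x hx

theorem MaxOpen.interior_closure {n : ℕ} {U : Set (E n)} (hU : MaxOpen U) :
    interior (closure U) = U := by
  have h : (interior U).Nonempty := by rw [hU.isOpen.interior_eq]; exact hU.nonempty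
  rw [hU.convex.interior_closure_eq_interior_of_nonempty_interior h, hU.isOpen.interior_eq]

theorem MaxOpen.sdim_closure {n : ℕ} {U : Set (E n)} (hU : MaxOpen U) :
    sdim (closure U) = n := by
  obtain ⟨p, hp⟩ := hU.nonempty
  rw [sdim, direction_eq ⊤ _ p (subset_closure hp) (fun _ _ => trivial)]
  · rw [finrank_top, finrank_euclideanSpace, Fintype.card_fin]
  · intro v _
    obtain ⟨t, ht, hm⟩ := exists_step_mem hU.isOpen hp v
    exact ⟨t, ht, subset_closure hm⟩

theorem MaxOpen.facet_sep {n : ℕ} {U : Set (E n)} (hU : MaxOpen U) {F : Set (E n)}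
    (hF : IsFacetOf F (closure U)) {y : E n} (hy : IsIntPt y) (hyF : y ∉ intrinsicInterior ℝ F) :
    ∃ (a : E n) (c : ℝ), a ≠ 0 ∧ (∀ x ∈ U, inner ℝ a x ≤ c) ∧ c ≤ inner ℝ a y ∧
      ∃ x ∈ F, inner ℝ a x < c := by
  obtain ⟨ι, hι, α, γ, hB⟩ := hU.poly
  have hmB : ∀ x, x ∈ closure U ↔ ∀ j, inner ℝ (α j) x ≤ γ j := by intro x; rw [hB]; rfl
  obtain ⟨hface, ⟨f, hf⟩, hdim⟩ := hF
  obtain ⟨u, hu⟩ := hU.nonempty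
  have h0 : ∀ j, α j = 0 → 0 ≤ γ j := by
    intro j hj
    have := (hmB u).1 (subset_closure hu) j
    rwa [hj, inner_zero_left] at this
  by_cases hyB : y ∈ closure U
  · by_contra hcon
    push Not at hcon
    have hact : ∀ j, inner ℝ (α j) y = γ j → ∀ x ∈ F, inner ℝ (α j) x = γ j := by
      intro j hj x hx
      apply le_antisymm ((hmB x).1 (hface.1 hx) j)
      by_cases hj0 : α j = 0
      · rw [← hj, hj0, inner_zero_left, inner_zero_left]
      · exact hcon _ _ hj0 (fun x hx => (hmB x).1 (subset_closure hx) j) hj.ge x hx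
    have hle : ∀ j, inner ℝ (α j) y = γ j →
        (affineSpan ℝ F).direction ≤ (Submodule.span ℝ {α j})ᗮ := by
      intro j hj
      apply direction_le _ F f hf
      intro x hx
      rw [Submodule.mem_orthogonal_singleton_iff_inner_right, inner_sub_right, hact j hj x hx,
        hact j hj f hf, sub_self]
    obtain ⟨j0, hj0, hj0'⟩ : ∃ j, inner ℝ (α j) y = γ j ∧ α j ≠ 0 := by
      by_contra hno
      push Not at hno
      have hyi := mem_interior_of_strict (fun j : {j // α j ≠ 0} => α j) (fun j => γ j) y (by
        intro j
        apply lt_of_le_of_ne ((hmB y).1 hyB j)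
        intro h
        exact j.2 (hno j h))
      have : {x : E n | ∀ j : {j // α j ≠ 0}, inner ℝ (α j) x ≤ γ j} ⊆ closure U := by
        intro x hx
        rw [hmB]
        intro j
        by_cases hj : α j = 0
        · rw [hj, inner_zero_left]; exact h0 j hj
        · exact hx ⟨j, hj⟩
      have h2 := interior_mono this hyi
      rw [hU.interior_closure] at h2
      exact hU.free y h2 hy
    have hdir : (affineSpan ℝ F).direction = (Submodule.span ℝ {α j0})ᗮ := by
      apply Submodule.eq_of_le_of_finrank_eq (hle j0 hj0)
      have h1 := finrank_ker_inner hj0'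
      rw [hU.sdim_closure, sdim] at hdim
      omega
    have hyA : y ∈ affineSpan ℝ F := by
      have h1 : y - f ∈ (affineSpan ℝ F).direction := by
        rw [hdir, Submodule.mem_orthogonal_singleton_iff_inner_right, inner_sub_right, hj0,
          hact j0 hj0 f hf, sub_self]
      have := AffineSubspace.vadd_mem_of_mem_direction h1 (subset_affineSpan ℝ F hf)
      simpa using this
    apply hyF
    refine ⟨⟨y, hyA⟩, ?_, rfl⟩
    rw [mem_interior_iff_mem_nhds]
    have hev : ∀ᶠ x : affineSpan ℝ F in nhds ⟨y, hyA⟩, ∀ j, inner ℝ (α j) (x : E n) ≤ γ j := by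
      rw [Filter.eventually_all]
      intro j
      rcases ((hmB y).1 hyB j).lt_or_eq with h | h
      · have hc : Continuous (fun x : affineSpan ℝ F => inner ℝ (α j) (x : E n)) := by fun_prop
        exact (hc.continuousAt.eventually_lt continuousAt_const h).mono (fun _ h => h.le)
      · refine Filter.Eventually.of_forall fun x => ?_
        have h1 : (x : E n) - y ∈ (affineSpan ℝ F).direction :=
          AffineSubspace.vsub_mem_direction x.2 hyA
        have h2 := hle j h h1
        rw [Submodule.mem_orthogonal_singleton_iff_inner_right, inner_sub_right] at h2
        linarith
    refine Filter.mem_of_superset hev ?_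
    intro x hx
    have hxB : (x : E n) ∈ closure U := (hmB _).2 hx
    obtain ⟨p, hp⟩ := Set.Nonempty.intrinsicInterior hface.2.1 ⟨f, hf⟩
    obtain ⟨t, ht, hm⟩ := relint_extend hp x.2
    exact face_seg hface (intrinsicInterior_subset hp) hxB ht (hface.1 hm)
  · rw [hmB] at hyB
    push Not at hyB
    obtain ⟨j, hj⟩ := hyB
    refine ⟨α j, inner ℝ (α j) y, ?_, ?_, le_rfl, f, hf, ?_⟩
    · intro h
      have := h0 j h
      rw [h, inner_zero_left] at hj
      linarith
    · intro x hx
      exact ((hmB x).1 (subset_closure hx) j).trans hj.le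
    · exact ((hmB f).1 (hface.1 hf) j).trans_lt hj

theorem MaxOpen.facet {n : ℕ} {U : Set (E n)} (hU : MaxOpen U) {F : Set (E n)}
    (hF : IsFacetOf F (closure U)) : ∃ z ∈ intrinsicInterior ℝ F, IsIntPt z := by
  by_contra hcon
  push Not at hcon
  have h : ∀ y : E n, ∃ (a : E n) (c : ℝ), IsIntPt y → a ≠ 0 ∧ (∀ x ∈ U, inner ℝ a x ≤ c) ∧
      c ≤ inner ℝ a y ∧ ∃ x ∈ F, inner ℝ a x < c := by
    intro y
    by_cases hy : IsIntPt y
    · obtain ⟨a, c, h⟩ := hU.facet_sep hF hy (fun h => hcon y h hy)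
      exact ⟨a, c, fun _ => h⟩
    · exact ⟨0, 0, fun h => absurd h hy⟩
  choose a c hac using h
  obtain ⟨ι, hι, α, γ, hB, hj⟩ := hU.finite_rep a c
    (fun y hy => (hac y hy).1) (fun y hy => (hac y hy).2.1) (fun y hy => (hac y hy).2.2.1)
  have hmB : ∀ x, x ∈ closure U ↔ ∀ j, inner ℝ (α j) x ≤ γ j := by intro x; rw [hB]; rfl
  obtain ⟨hface, ⟨f, hf⟩, hdim⟩ := hF
  have hx : ∀ j, ∃ x ∈ F, inner ℝ (α j) x < γ j := by
    intro j
    rcases hj j with ⟨y, hy, h1, h2⟩ | h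
    · rw [h1, h2]; exact (hac y hy).2.2.2
    · exact ⟨f, hf, h f (hface.1 hf)⟩
  obtain ⟨p, hp⟩ := Set.Nonempty.intrinsicInterior hface.2.1 ⟨f, hf⟩
  have hps : ∀ j, inner ℝ (α j) p < γ j := by
    intro j
    obtain ⟨x, hxF, hxs⟩ := hx j
    obtain ⟨t, ht, hm⟩ := relint_extend hp (subset_affineSpan ℝ F hxF)
    have h1 := (hmB _).1 (hface.1 hm) j
    rw [inner_add_right, inner_smul_right, inner_sub_right] at h1
    nlinarith
  have hpi : p ∈ U := by
    rw [← hU.interior_closure, hB]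
    exact mem_interior_of_strict α γ p hps
  have hFB : F = closure U := by
    apply hface.1.antisymm
    intro x hxB
    obtain ⟨t, ht, hm⟩ := exists_step_mem hU.isOpen hpi (p - x)
    exact face_seg hface (intrinsicInterior_subset hp) hxB ht (subset_closure hm)
  rw [hFB] at hdim
  omega

theorem MaxLatticeFree.maxOpen {n : ℕ} {B : Set (E n)} (hB : MaxLatticeFree B)
    (hne : (interior B).Nonempty) : MaxOpen (interior B) ∧ closure (interior B) = B := by
  obtain ⟨hconv, hfree, hmax⟩ := hB
  have hcl : closure (interior B) = closure B :=
    hconv.closure_interior_eq_closure_of_nonempty_interior hne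
  refine ⟨⟨isOpen_interior, hconv.interior, hne, hfree, ?_⟩, ?_⟩
  · intro C hCo hC hCf hBC
    have hCi : (interior C).Nonempty := by rw [hCo.interior_eq]; exact hne.mono hBC
    have hci : interior (closure C) = C := by
      rw [hC.interior_closure_eq_interior_of_nonempty_interior hCi, hCo.interior_eq]
    have h1 : B = closure C := by
      apply hmax _ hC.closure
      · intro x hx
        rw [hci] at hx
        exact hCf x hx
      · exact (subset_closure.trans hcl.ge).trans (closure_mono hBC)
    rw [h1, hci]
  · rw [hcl]
    symm
    apply hmax _ hconv.closure _ subset_closure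
    intro x hx
    rw [hconv.interior_closure_eq_interior_of_nonempty_interior hne] at hx
    exact hfree x hx

theorem MaxOpen.main {n : ℕ} {U : Set (E n)} (hU : MaxOpen U) :
    (IsPolyhedron (closure U) ∧
      ∃ (P : Set (E n)) (L : Submodule ℝ (E n)),
        IsPolytope P ∧ IsRationalSubspace L ∧ closure U = P + (L : Set (E n)) ∧
        sdim (closure U) = sdim P + Module.finrank ℝ L ∧ sdim (closure U) = n ∧
        (∀ x ∈ interior (closure U), ¬ IsIntPt x) ∧
        (∀ F : Set (E n), IsFacetOf F (closure U) → ∃ z ∈ intrinsicInterior ℝ F, IsIntPt z)) := by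
  obtain ⟨ι, hι, α, γ, hB⟩ := hU.poly
  have hmB : ∀ x, x ∈ closure U ↔ ∀ j, inner ℝ (α j) x ≤ γ j := by intro x; rw [hB]; rfl
  have htr : ∀ x ∈ closure U, ∀ d ∈ Lin U, x + d ∈ closure U := by
    intro x hx d hd
    rw [hmB] at hx ⊢
    intro j
    have h1 := perp_of_bdd hU.nonempty (fun y hy => (hmB y).1 (subset_closure hy) j) hd
    rw [inner_add_right, h1, add_zero]
    exact hx j
  have hprj : ∀ x ∈ closure U, prj U x ∈ closure U := by
    intro x hx
    have := htr x hx _ ((Lin U).neg_mem (sub_prj_mem U x))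
    simpa using this
  let P : Set (E n) := closure U ∩ ((Lin U)ᗮ : Submodule ℝ (E n))
  have hPb : Bornology.IsBounded P := by
    obtain ⟨M, hM⟩ := hU.bound
    have h1 : closure U ⊆ {x | ‖prj U x‖ ≤ M} := by
      apply closure_minimal
      · exact hM
      · exact isClosed_le (by fun_prop) (by fun_prop)
    refine (Metric.isBounded_closedBall (x := (0 : E n)) (r := M)).subset ?_
    rintro x ⟨hx, hxL⟩
    have h2 := h1 hx
    have h3 : prj U x = x := Submodule.starProjection_eq_self_iff.mpr hxL
    simp only [Set.mem_ofPred_eq, h3] at h2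
    simpa using h2
  have hsdimP : sdim P = Module.finrank ℝ (Lin U)ᗮ := by
    obtain ⟨u, hu⟩ := hU.nonempty
    have hq : prj U u ∈ U := (mem_iff_of_sub_mem (sub_prj_mem U u)).1 hu
    rw [sdim, direction_eq (Lin U)ᗮ P (prj U u) ⟨subset_closure hq, prj_mem U u⟩]
    · intro x hx
      exact Submodule.sub_mem _ hx.2 (prj_mem U u)
    · intro v hv
      obtain ⟨t, ht, hm⟩ := exists_step_mem hU.isOpen hq v
      exact ⟨t, ht, subset_closure hm, Submodule.add_mem _ (prj_mem U u) (Submodule.smul_mem _ _ hv)⟩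
  refine ⟨by rw [hB]; exact isPolyhedron_of_finite α γ, P, Lin U,
    polytope_of α γ (Lin U)ᗮ P (by rw [← hB]) hPb, hU.rational, ?_, ?_, hU.sdim_closure, ?_,
    fun F hF => hU.facet hF⟩
  · apply Set.Subset.antisymm
    · intro x hx
      exact ⟨prj U x, ⟨hprj x hx, prj_mem U x⟩, x - prj U x, sub_prj_mem U x, by simp⟩
    · rintro _ ⟨x, hx, d, hd, rfl⟩
      exact htr x hx.1 d hd
  · rw [hU.sdim_closure, hsdimP]
    have h := Submodule.finrank_add_finrank_orthogonal (Lin U)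
    rw [finrank_euclideanSpace, Fintype.card_fin] at h
    omega
  · rw [hU.interior_closure]
    exact hU.free

theorem zero_dim_case {B : Set (E 0)} (hB : MaxLatticeFree B) : B = ∅ := by
  rw [Set.eq_empty_iff_forall_notMem]
  intro x hx
  have : B = Set.univ := Set.eq_univ_of_forall (fun y => by rwa [Subsingleton.elim y x])
  exact hB.2.1 x (by rw [this]; simp) (fun i => i.elim0)



/-- Lovász's characterization of maximal lattice-free convex sets. -/
theorem stmt_0 {n : ℕ} (B : Set (E n)) :
    MaxLatticeFree B ↔
    ((IsPolyhedron B ∧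
      ∃ (P : Set (E n)) (L : Submodule ℝ (E n)),
        IsPolytope P ∧ IsRationalSubspace L ∧ B = P + (L : Set (E n)) ∧
        sdim B = sdim P + Module.finrank ℝ L ∧ sdim B = n ∧
        (∀ x ∈ interior B, ¬ IsIntPt x) ∧
        (∀ F : Set (E n), IsFacetOf F B → ∃ z ∈ intrinsicInterior ℝ F, IsIntPt z))
    ∨ (∃ (a : E n) (β : ℝ), a ≠ 0 ∧ B = {x | dot a x = β} ∧
        ¬ ∃ (c : ℝ) (v : E n), IsRatVec v ∧ a = c • v)) := by
  constructor
  · intro hB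
    rcases (interior B).eq_empty_or_nonempty with hemp | hne
    · rcases Nat.eq_zero_or_pos n with hn | hn
      · subst hn
        left
        have hBe := zero_dim_case hB
        subst hBe
        refine ⟨⟨1, fun _ => 0, fun _ => -1, ?_⟩, ∅, ⊥, ⟨∅, by simp⟩, ⟨∅, by simp, by simp⟩, by simp,
          by simp [sdim], by simp [sdim], by simp, ?_⟩
        · ext x
          simp [dot]
        · rintro F ⟨⟨hF, -⟩, ⟨f, hf⟩, -⟩
          exact absurd (hF hf) (Set.notMem_empty f)
      · right
        exact empty_interior_case hn hB hemp
    · left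
      obtain ⟨hU, hcl⟩ := hB.maxOpen hne
      have := hU.main
      rwa [hcl] at this
  · rintro (⟨hP, P, L, -, -, -, -, hdim, hfree, hfac⟩ | ⟨a, β, ha, rfl, hirr⟩)
    · exact poly_max B hP hdim hfree hfac
    · exact hyper_max a β ha hirr
end
end

section
/- If B ⊂ ℝⁿ is a maximal S-free convex set such that B ∩ conv(S) has nonempty interior, then the recession cone of B ∩ conv(S) is rational (generated by vectors with rational coordinates) and is contained in the lineality space of B. -/
open scoped BigOperators Pointwise

noncomputable section

theorem aux_disc {V : Type*} [NormedAddCommGroup V] [InnerProductSpace ℝ V]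
    [FiniteDimensional ℝ V] (D : AddSubgroup V) (hD : IsClosed (D : Set V))
    (hno : ∀ u : V, (∀ t : ℝ, t • u ∈ D) → u = 0) :
    ∃ ε > 0, ∀ x ∈ D, ‖x‖ < ε → x = 0 := by
  by_contra hcon
  push Not at hcon
  choose x hxD hxn hx0 using fun k : ℕ => hcon (1 / ((k : ℝ) + 1)) (by positivity)
  have hpos : ∀ k, 0 < ‖x k‖ := fun k => norm_pos_iff.mpr (hx0 k)
  obtain ⟨u, hu, φ, hφ, hlim⟩ := (isCompact_sphere (0 : V) 1).tendsto_subseq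
    (x := fun k => ‖x k‖⁻¹ • x k) (fun k => by
      simp [norm_smul, (hpos k).ne'])
  have hx_lim : Filter.Tendsto (fun k => ‖x (φ k)‖) Filter.atTop (nhds 0) := by
    have h1 : Filter.Tendsto (fun k => ‖x k‖) Filter.atTop (nhds 0) :=
      squeeze_zero (fun k => norm_nonneg _) (fun k => (hxn k).le)
        tendsto_one_div_add_atTop_nhds_zero_nat
    exact h1.comp hφ.tendsto_atTop
  have hu0 : u = 0 := by
    apply hno
    intro t
    have h2 : Filter.Tendsto (fun k => (⌊t / ‖x (φ k)‖⌋ : ℝ) * ‖x (φ k)‖) Filter.atTop (nhds t) := by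
      rw [tendsto_iff_norm_sub_tendsto_zero]
      refine squeeze_zero (fun k => norm_nonneg _) (fun k => ?_) hx_lim
      have hp := hpos (φ k)
      have h3 := Int.floor_le (t / ‖x (φ k)‖)
      have h4 := Int.lt_floor_add_one (t / ‖x (φ k)‖)
      rw [le_div_iff₀ hp] at h3
      rw [div_lt_iff₀ hp] at h4
      rw [Real.norm_eq_abs, abs_le]
      constructor <;> nlinarith
    have h5 := h2.smul hlim
    refine hD.mem_of_tendsto h5 (Filter.Eventually.of_forall fun k => ?_)
    have h6 : ((⌊t / ‖x (φ k)‖⌋ : ℝ) * ‖x (φ k)‖) • ((fun k => ‖x k‖⁻¹ • x k) ∘ φ) k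
        = ⌊t / ‖x (φ k)‖⌋ • x (φ k) := by
      simp only [Function.comp]
      rw [smul_smul, mul_assoc, mul_inv_cancel₀ (hpos _).ne', mul_one, Int.cast_smul_eq_zsmul]
    rw [SetLike.mem_coe, h6]
    exact D.zsmul_mem (hxD _) _
  subst hu0
  simp at hu

theorem aux_dirichlet {k : ℕ} (β : Fin k → ℝ) (ε N : ℝ) (hε : 0 < ε) :
    ∃ t : ℝ, N ≤ t ∧ ∃ m : Fin k → ℤ, ∀ j, |m j - t * β j| < ε := by
  obtain ⟨M, hM⟩ := exists_nat_ge N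
  let M' := M + 1
  obtain ⟨u, -, φ, hφ, hlim⟩ := (isCompact_univ_pi (fun _ : Fin k => isCompact_Icc (a := (0:ℝ)) (b := 1))).tendsto_subseq
    (x := fun (i : ℕ) (j : Fin k) => Int.fract ((i * M' : ℝ) * β j)) (fun i j _ => 
      ⟨Int.fract_nonneg _, (Int.fract_lt_one _).le⟩)
  have hc := hlim.cauchySeq
  rw [Metric.cauchySeq_iff] at hc
  obtain ⟨K, hK⟩ := hc ε hε
  have h1 := hK (K + 1) (by simp) K le_rfl
  have hlt : φ K < φ (K + 1) := hφ (by simp)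
  refine ⟨((φ (K+1) : ℝ) - φ K) * M', ?_, fun j => ⌊((φ (K+1)) * M' : ℝ) * β j⌋ - ⌊((φ K) * M' : ℝ) * β j⌋, fun j => ?_⟩
  · have : (φ K : ℝ) + 1 ≤ φ (K+1) := by exact_mod_cast hlt
    have h2 : (M' : ℝ) = M + 1 := by simp [M']
    have h3 : (0:ℝ) ≤ M := by positivity
    nlinarith
  · have h2 := (dist_pi_lt_iff hε).1 h1 j
    simp only [Function.comp, Real.dist_eq, Int.fract] at h2
    rw [abs_sub_comm] 
    push_cast
    convert h2 using 2
    ring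

theorem aux_dense {k : ℕ} (β : Fin k → ℝ) (hβ : LinearIndependent ℚ β)
    (D : AddSubgroup (EuclideanSpace ℝ (Fin k))) (hD : IsClosed (D : Set (EuclideanSpace ℝ (Fin k))))
    (h1 : ∀ j, EuclideanSpace.single j (1:ℝ) ∈ D)
    (h2 : ∀ t : ℝ, t • (WithLp.toLp 2 β) ∈ D) : D = ⊤ := by
  let V := EuclideanSpace ℝ (Fin k)
  let D0 : Submodule ℝ V :=
    { carrier := {v | ∀ t : ℝ, t • v ∈ D}
      add_mem' := fun {a b} ha hb t => by rw [smul_add]; exact D.add_mem (ha t) (hb t)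
      zero_mem' := fun t => by rw [smul_zero]; exact D.zero_mem
      smul_mem' := fun c x hx t => by rw [smul_smul]; exact hx _ }
  have hD0 : ∀ v, v ∈ D0 → v ∈ D := fun v hv => by simpa using hv 1
  by_cases htop : D0 = ⊤
  · rw [eq_top_iff]
    intro v _
    exact hD0 v (by rw [htop]; trivial)
  exfalso
  let L : AddSubgroup D0ᗮ := D.comap (D0ᗮ.subtype.toAddMonoidHom)
  have hL : ∀ x : D0ᗮ, x ∈ L ↔ (x : V) ∈ D := fun x => Iff.rfl
  have hproj : ∀ v : V, v ∈ D → D0ᗮ.orthogonalProjectionOnto v ∈ L := by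
    intro v hv
    rw [hL]
    have h3 := D0.starProjection_add_starProjection_orthogonal v
    have : (D0ᗮ.orthogonalProjectionOnto v : V) = v - D0.starProjection v := by
      rw [← Submodule.starProjection_apply]
      exact eq_sub_of_add_eq' h3
    rw [this]
    exact D.sub_mem hv (hD0 _ (Submodule.starProjection_apply_mem _ _))
  obtain ⟨ε, hε, hdisc⟩ := aux_disc L (hD.preimage continuous_subtype_val) (by
    intro u hu
    have : (u : V) ∈ D0 := fun t => hu t
    have h4 := Submodule.inner_right_of_mem_orthogonal this u.2
    rw [inner_self_eq_zero] at h4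
    exact Subtype.ext h4)
  let Lz : Submodule ℤ D0ᗮ := AddSubgroup.toIntSubmodule L
  have : DiscreteTopology Lz := by
    refine discreteTopology_iff_isOpen_singleton_zero.mpr ⟨Metric.ball 0 ε, Metric.isOpen_ball, ?_⟩
    ext x
    simp only [Set.mem_preimage, Metric.mem_ball, dist_zero_right, Set.mem_singleton_iff]
    constructor
    · intro h
      exact Subtype.ext (hdisc x.1 x.2 h)
    · rintro rfl
      simpa using hε
  have hsp : IsZLattice ℝ Lz := ⟨by
    rw [eq_top_iff]
    have h5 : (⊤ : Submodule ℝ D0ᗮ) = Submodule.map (D0ᗮ.orthogonalProjectionOnto : V →ₗ[ℝ] D0ᗮ)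
        (Submodule.span ℝ (Set.range (EuclideanSpace.basisFun (Fin k) ℝ))) := by
      rw [← OrthonormalBasis.coe_toBasis, Module.Basis.span_eq, Submodule.map_top, eq_comm, LinearMap.range_eq_top]
      intro x
      exact ⟨x, by simp⟩
    rw [h5, Submodule.map_span]
    apply Submodule.span_mono
    rintro _ ⟨_, ⟨j, rfl⟩, rfl⟩
    exact hproj _ (by simpa using h1 j)⟩
  have : Module.Free ℤ Lz := ZLattice.module_free ℝ Lz
  let b := Module.Free.chooseBasis ℤ Lz
  let bR := b.ofZLatticeBasis ℝ Lz
  have hne : Nonempty (Module.Free.ChooseBasisIndex ℤ Lz) := by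
    by_contra hemp
    rw [not_nonempty_iff] at hemp
    apply htop
    rw [← Submodule.orthogonal_eq_bot_iff]
    have : Subsingleton D0ᗮ := bR.repr.toEquiv.subsingleton
    exact Submodule.eq_bot_of_subsingleton
  obtain ⟨i⟩ := hne
  let f : V →ₗ[ℝ] ℝ := (bR.coord i) ∘ₗ (D0ᗮ.orthogonalProjectionOnto : V →ₗ[ℝ] D0ᗮ)
  have hfint : ∀ v ∈ D, ∃ m : ℤ, f v = m := by
    intro v hv
    refine ⟨b.repr ⟨_, hproj v hv⟩ i, ?_⟩
    have := b.ofZLatticeBasis_repr_apply ℝ Lz ⟨_, hproj v hv⟩ i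
    exact this
  choose m hm using fun j => hfint _ (h1 j)
  have hβ0 : f (WithLp.toLp 2 β) = 0 := by
    have h6 : (WithLp.toLp 2 β : V) ∈ D0 := h2
    have : D0ᗮ.orthogonalProjectionOnto (WithLp.toLp 2 β : V) = 0 := by
      apply Submodule.orthogonalProjectionOnto_apply_of_mem_orthogonal
      rwa [Submodule.orthogonal_orthogonal]
    simp [f, this]
  have hfexp : ∀ v : V, f v = ∑ j, v j * m j := by
    intro v
    conv_lhs => rw [← (EuclideanSpace.basisFun (Fin k) ℝ).sum_repr v]
    rw [map_sum]
    refine Finset.sum_congr rfl fun j _ => ?_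
    rw [map_smul, EuclideanSpace.basisFun_apply, hm]
    simp
  rw [hfexp] at hβ0
  have hm0 : ∀ j, m j = 0 := by
    have := Fintype.linearIndependent_iff.1 hβ (fun j => (m j : ℚ)) (by
      rw [← hβ0]
      refine Finset.sum_congr rfl fun j _ => ?_
      simp [Rat.smul_def, mul_comm])
    intro j
    exact_mod_cast this j
  have h7 : f (bR i : D0ᗮ) = 0 := by rw [hfexp]; simp [hm0]
  simp [f] at h7

theorem aux_kronecker {k : ℕ} (β : Fin k → ℝ) (hβ : LinearIndependent ℚ β) (θ : Fin k → ℝ)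
    (ε N : ℝ) (hε : 0 < ε) :
    ∃ t : ℝ, N ≤ t ∧ ∃ m : Fin k → ℤ, ∀ j, |m j - t * β j - θ j| < ε := by
  let D1 : AddSubgroup (EuclideanSpace ℝ (Fin k)) :=
    { carrier := {v | ∃ t : ℝ, ∃ m : Fin k → ℤ, ∀ j, v j = m j - t * β j}
      add_mem' := by
        rintro a b ⟨t, m, h⟩ ⟨t', m', h'⟩
        refine ⟨t + t', m + m', fun j => ?_⟩
        simp [h, h']; ring
      zero_mem' := ⟨0, 0, by simp⟩
      neg_mem' := by
        rintro a ⟨t, m, h⟩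
        refine ⟨-t, -m, fun j => ?_⟩
        simp [h]; ring }
  have htop := aux_dense β hβ D1.topologicalClosure D1.isClosed_topologicalClosure
    (fun j => D1.le_topologicalClosure ⟨0, Pi.single j 1, fun i => by
      by_cases h : i = j
      · subst h; simp
      · simp [h]⟩)
    (fun t => D1.le_topologicalClosure ⟨-t, 0, fun i => by simp⟩)
  have hmem : (WithLp.toLp 2 θ : EuclideanSpace ℝ (Fin k)) ∈ closure (D1 : Set (EuclideanSpace ℝ (Fin k))) := by
    rw [← AddSubgroup.topologicalClosure_coe, htop]; trivial
  rw [Metric.mem_closure_iff] at hmem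
  obtain ⟨v, ⟨t, m, hv⟩, hd⟩ := hmem (ε / 2) (by positivity)
  obtain ⟨t', ht', m', hm'⟩ := aux_dirichlet β (ε / 2) (N - t) (by positivity)
  refine ⟨t + t', by linarith, m + m', fun j => ?_⟩
  have h1 : |θ j - v j| < ε / 2 := by
    refine lt_of_le_of_lt ?_ hd
    rw [dist_eq_norm]
    exact PiLp.norm_apply_le (WithLp.toLp 2 θ - v) j
  have h2 := hm' j
  rw [hv] at h1
  rw [abs_lt] at h1 h2 ⊢
  simp only [Pi.add_apply, Int.cast_add]
  constructor <;> linarith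

theorem dot_add' {n : ℕ} (a x y : E n) : dot a (x + y) = dot a x + dot a y := by
  simp [dot, mul_add, Finset.sum_add_distrib]

theorem dot_smul' {n : ℕ} (a x : E n) (t : ℝ) : dot a (t • x) = t * dot a x := by
  simp only [dot, Finset.mul_sum]
  refine Finset.sum_congr rfl fun i _ => ?_
  simp; ring

theorem dot_comb {n k : ℕ} (a : E n) (c : Fin k → ℝ) (v : Fin k → E n) :
    dot a (∑ j, c j • v j) = ∑ j, c j * dot a (v j) := by
  have : ∀ s : Finset (Fin k), dot a (∑ j ∈ s, c j • v j) = ∑ j ∈ s, c j * dot a (v j) := by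
    intro s
    induction s using Finset.induction_on with
    | empty => simp [dot]
    | insert i s hi ih => rw [Finset.sum_insert hi, Finset.sum_insert hi, dot_add', dot_smul', ih]
  exact this _

/-- clearing denominators of a finite family of rationals -/
theorem aux_denom {ι : Type*} [Fintype ι] (q : ι → ℚ) :
    ∃ M : ℕ, 0 < M ∧ ∀ i, ∃ z : ℤ, (M : ℚ) * q i = z := by
  classical
  refine ⟨∏ i, (q i).den, Finset.prod_pos fun i _ => (q i).den_pos, fun i => ?_⟩
  obtain ⟨c, hc⟩ := Finset.dvd_prod_of_mem (fun i => (q i).den) (Finset.mem_univ i)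
  refine ⟨c * (q i).num, ?_⟩
  rw [hc]
  push_cast
  have := Rat.mul_den_eq_num (q i)
  rw [← this]; ring

theorem aux_decomp {n : ℕ} (r : E n) : ∃ (k : ℕ) (β : Fin k → ℝ) (w : Fin k → Fin n → ℤ),
    LinearIndependent ℚ β ∧ ∀ i, r i = ∑ j, β j * w j i := by
  let U : Submodule ℚ ℝ := Submodule.span ℚ (Set.range fun i => r i)
  have : FiniteDimensional ℚ U := FiniteDimensional.span_of_finite ℚ (Set.finite_range _)
  let b := Module.finBasis ℚ U
  have hr : ∀ i, r i ∈ U := fun i => Submodule.subset_span ⟨i, rfl⟩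
  obtain ⟨M, hM, hz⟩ := aux_denom (fun p : Fin (Module.finrank ℚ U) × Fin n => b.repr ⟨r p.2, hr p.2⟩ p.1)
  choose z hz using hz
  have hM0 : (M : ℝ) ≠ 0 := by exact_mod_cast hM.ne'
  have hMq : (M : ℚ)⁻¹ ≠ 0 := by simpa using hM.ne'
  refine ⟨_, fun j => (M : ℚ)⁻¹ • (b j : ℝ), fun j i => z (j, i), ?_, fun i => ?_⟩
  · have h1 : LinearIndependent ℚ (fun j => (b j : ℝ)) :=
      b.linearIndependent.map' U.subtype (Submodule.ker_subtype U)
    exact h1.units_smul (fun _ => Units.mk0 _ hMq)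
  · have h2 := congrArg (Subtype.val) (b.sum_repr ⟨r i, hr i⟩)
    simp only [Submodule.coe_sum, Submodule.coe_smul] at h2
    rw [← h2]
    refine Finset.sum_congr rfl fun j _ => ?_
    have h3 : ((M : ℝ)) * ((b.repr ⟨r i, hr i⟩ j : ℚ) : ℝ) = z (j, i) := by
      exact_mod_cast hz (j, i)
    beta_reduce
    rw [← h3, Rat.smul_def, Rat.smul_def]
    push_cast
    field_simp

theorem aux_bound {m : ℕ} (c M : Fin m → ℝ) (hM : ∀ i, 0 ≤ M i) :
    ∃ N : ℝ, 0 ≤ N ∧ ∀ i, c i < 0 → N * c i + M i ≤ 0 := by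
  have h0 : ∀ i, 0 ≤ M i / |c i| := fun i => div_nonneg (hM i) (abs_nonneg _)
  refine ⟨∑ i, M i / |c i|, Finset.sum_nonneg fun i _ => h0 i, fun i hi => ?_⟩
  have h1 := Finset.single_le_sum (fun i _ => h0 i) (Finset.mem_univ i)
  have h2 : M i / |c i| * c i = - M i := by
    have := hi.ne
    rw [abs_of_neg hi]; field_simp
  nlinarith

theorem aux_closed {n : ℕ} {S B : Set (E n)} (hB : MaxSFree S B) (hne : (interior B).Nonempty) :
    IsClosed B := by
  obtain ⟨hc, hf, hmax⟩ := hB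
  have := hmax (closure B) hc.closure (by
    unfold SFree
    rw [hc.interior_closure_eq_interior_of_nonempty_interior hne]
    exact hf) subset_closure
  rw [this]; exact isClosed_closure

theorem aux_rec {n : ℕ} {B : Set (E n)} (hc : Convex ℝ B) (hcl : IsClosed B) (x0 r : E n)
    (h : ∀ t : ℝ, 0 ≤ t → x0 + t • r ∈ B) : r ∈ recCone B := by
  intro x hx t ht
  have hl : Filter.Tendsto (fun k : ℕ => (1 / ((k : ℝ) + 1))) Filter.atTop (nhds 0) :=
    tendsto_one_div_add_atTop_nhds_zero_nat
  have hlim : Filter.Tendsto (fun k : ℕ => x + t • r + (1 / ((k : ℝ) + 1)) • (x0 - x))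
      Filter.atTop (nhds (x + t • r)) := by
    simpa using (hl.smul_const (x0 - x)).const_add (x + t • r)
  refine hcl.mem_of_tendsto hlim (Filter.Eventually.of_forall fun k => ?_)
  have hk : (0:ℝ) < (k : ℝ) + 1 := by positivity
  have h1 := hc hx (h (t * (k + 1)) (by positivity)) (a := 1 - 1 / ((k : ℝ) + 1))
    (b := 1 / ((k : ℝ) + 1)) (by
      rw [sub_nonneg, div_le_one hk]
      have : (0:ℝ) ≤ k := by positivity
      linarith) (by positivity) (by ring)
  convert h1 using 1
  rw [smul_add, smul_smul]
  have : 1 / ((k : ℝ) + 1) * (t * (k + 1)) = t := by field_simp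
  rw [this]
  module

theorem aux_int_rec {n : ℕ} {B : Set (E n)} {r : E n} (hr : r ∈ recCone B) (x : E n)
    (hx : x ∈ interior B) (t : ℝ) (ht : 0 ≤ t) : x + t • r ∈ interior B := by
  rw [mem_interior] at hx ⊢
  obtain ⟨U, hU, hUo, hxU⟩ := hx
  refine ⟨(fun y => y + t • r) '' U, ?_, ?_, ⟨x, hxU, rfl⟩⟩
  · rintro _ ⟨y, hy, rfl⟩
    exact hr y (hU hy) t ht
  · exact (Homeomorph.addRight (t • r)).isOpenMap U hUo

/-- if no translate of a point of `S` along `V` meets `int B`, then `V ⊆ lin B` -/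
theorem aux_max {n : ℕ} {S B : Set (E n)} (hB : MaxSFree S B) (hne : (interior B).Nonempty)
    (V : Submodule ℝ (E n)) (hV : ∀ y ∈ S, ∀ v ∈ V, y + v ∉ interior B) :
    ∀ v ∈ V, v ∈ recCone B := by
  obtain ⟨hc, hf, hmax⟩ := hB
  obtain ⟨b0, hb0⟩ := hne
  have := hmax (B + (V : Set (E n))) (hc.add V.convex) (by
    intro x hx hxS
    have hcont : Filter.Tendsto (fun s : ℝ => x + s • (x - b0)) (nhdsWithin 0 (Set.Ioi 0)) (nhds x) := by
      have : Continuous (fun s : ℝ => x + s • (x - b0)) := by fun_prop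
      have h := this.tendsto 0
      simp only [zero_smul, add_zero] at h
      exact h.mono_left nhdsWithin_le_nhds
    have h1 := hcont.eventually (mem_interior_iff_mem_nhds.1 hx)
    obtain ⟨s, hs, hs0⟩ := (h1.and self_mem_nhdsWithin).exists
    obtain ⟨b, hb, v, hv, hbv⟩ := Set.mem_add.1 hs
    apply hV x hxS (-((1 / (1 + s)) • v)) (V.neg_mem (V.smul_mem _ hv))
    have h2 := hc.combo_interior_self_mem_interior hb0 hb (a := s / (1 + s)) (b := 1 / (1 + s))
      (by positivity) (by positivity) (by field_simp; ring)
    convert h2 using 1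
    have h3 : b = x + s • (x - b0) - v := by rw [← hbv]; abel
    have h4 : x = (1 / (1 + s)) • ((1 + s) • x) := by
      rw [smul_smul]
      have : 1 / (1 + s) * (1 + s) = 1 := by field_simp
      rw [this, one_smul]
    have h5 : (s / (1 + s)) • b0 = (1 / (1 + s)) • (s • b0) := by
      rw [smul_smul]; congr 1; field_simp
    rw [h5, h3]
    conv_lhs => rw [h4]
    module) (by
    intro x hx
    exact ⟨x, hx, 0, V.zero_mem, by simp⟩)
  intro v hv x hx t _
  rw [this]
  exact ⟨x, hx, t • v, V.smul_mem _ hv, rfl⟩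

theorem aux_conv_rec {n m : ℕ} (A : Fin m → E n) (b : Fin m → ℝ) (g : E n) (hg : IsRatVec g)
    (hAg : ∀ i, dot (A i) g ≤ 0) :
    g ∈ recCone (convexHull ℝ {x : E n | IsIntPt x ∧ ∀ i, dot (A i) x ≤ b i}) := by
  set S := {x : E n | IsIntPt x ∧ ∀ i, dot (A i) x ≤ b i} with hS
  intro x hx t ht
  choose q hq using hg
  obtain ⟨M, hM, hz⟩ := aux_denom q
  choose z hz using hz
  have hM0 : (0 : ℝ) < M := by exact_mod_cast hM
  have key : ∀ s ∈ S, s + t • g ∈ convexHull ℝ S := by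
    intro s hs
    obtain ⟨k, hk⟩ := exists_nat_ge (t / M)
    have hk1 : t ≤ ((k : ℝ) + 1) * M := by
      rw [div_le_iff₀ hM0] at hk; nlinarith
    have hpos : 0 < ((k : ℝ) + 1) * M := by positivity
    have hs' : s + (((k : ℝ) + 1) * M) • g ∈ S := by
      refine ⟨fun i => ?_, fun i => ?_⟩
      · obtain ⟨a, ha⟩ := hs.1 i
        refine ⟨a + (k + 1) * z i, ?_⟩
        have : (M : ℝ) * q i = z i := by exact_mod_cast hz i
        simp only [PiLp.add_apply, PiLp.smul_apply, smul_eq_mul, ha, hq]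
        push_cast
        rw [← this]; ring
      · rw [dot_add', dot_smul']
        have h1 := hs.2 i
        have h2 := mul_nonpos_of_nonneg_of_nonpos hpos.le (hAg i)
        linarith
    have h3 := convex_convexHull ℝ S (subset_convexHull ℝ S hs) (subset_convexHull ℝ S hs')
      (a := 1 - t / (((k : ℝ) + 1) * M)) (b := t / (((k : ℝ) + 1) * M))
      (by rw [sub_nonneg, div_le_one hpos]; exact hk1) (by positivity) (by ring)
    convert h3 using 1
    rw [smul_add, smul_smul, div_mul_cancel₀ _ hpos.ne']
    module
  have hsub : convexHull ℝ S ⊆ (fun y => y + t • g) ⁻¹' (convexHull ℝ S) :=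
    convexHull_min key ((convex_convexHull ℝ S).translate_preimage_left (t • g))
  exact hsub hx

theorem aux_cone {n : ℕ} (K G : Set (E n)) (hG : G ⊆ recCone K) : conicHullOf G ⊆ recCone K := by
  rintro x ⟨m, c, v, hc, hv, rfl⟩
  have : ∀ s : Finset (Fin m), ∑ i ∈ s, c i • v i ∈ recCone K := by
    intro s
    induction s using Finset.induction_on with
    | empty => intro x hx t _; simpa using hx
    | insert i s hi ih =>
      intro x hx t ht
      rw [Finset.sum_insert hi, smul_add, smul_smul, ← add_assoc]
      exact ih _ (hG (hv i) x hx _ (mul_nonneg ht (hc i))) t ht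
  exact this _

theorem aux_hull {n : ℕ} (G : Set (E n)) : convexHull ℝ G ⊆ conicHullOf G := by
  intro x hx
  rw [mem_convexHull_iff_exists_fintype] at hx
  obtain ⟨ι, _, w, z, hw, _, hz, rfl⟩ := hx
  let e := (Fintype.equivFin ι).symm
  exact ⟨_, fun i => w (e i), fun i => z (e i), fun i => hw _, fun i => hz _,
    (Equiv.sum_comp e (fun i => w i • z i)).symm⟩

theorem aux_box {k : ℕ} (β : Fin k → ℝ) (δ : ℝ) (hδ : 0 < δ) :
    β ∈ convexHull ℝ {γ : Fin k → ℝ | (∀ j, ∃ q : ℚ, γ j = q) ∧ ∀ j, |γ j - β j| ≤ δ} := by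
  choose a ha1 ha2 using fun j => exists_rat_btwn (show β j - δ < β j by linarith)
  choose c hc1 hc2 using fun j => exists_rat_btwn (show β j < β j + δ by linarith)
  have h1 : β ∈ convexHull ℝ (Set.univ.pi fun j => ({(a j : ℝ), (c j : ℝ)} : Set ℝ)) := by
    rw [convexHull_pi]
    intro j _
    beta_reduce
    rw [convexHull_pair, segment_eq_Icc ((ha2 j).trans (hc1 j)).le]
    exact ⟨(ha2 j).le, (hc1 j).le⟩
  refine convexHull_mono ?_ h1
  intro γ hγ
  refine ⟨fun j => ?_, fun j => ?_⟩
  · rcases hγ j trivial with h | h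
    · exact ⟨_, h⟩
    · exact ⟨_, h⟩
  · have := ha1 j
    have := ha2 j
    have := hc1 j
    have := hc2 j
    rw [abs_le]
    rcases hγ j trivial with h | h
    · rw [h]; constructor <;> linarith
    · rw [Set.mem_singleton_iff] at h
      rw [h]; constructor <;> linarith

/-- core: every recession direction is in `lin B` and is a nonnegative combination of
rational recession directions. -/
theorem aux_core {n m : ℕ} (A : Fin m → E n) (b : Fin m → ℝ) (hA : ∀ i, IsRatVec (A i))
    (B : Set (E n)) (hB : MaxSFree {x : E n | IsIntPt x ∧ ∀ i, dot (A i) x ≤ b i} B)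
    (hne : (interior B).Nonempty) (r : E n) (hr : r ∈ recCone B) (hAr : ∀ i, dot (A i) r ≤ 0) :
    r ∈ linSpace B ∧ r ∈ convexHull ℝ {g : E n | IsRatVec g ∧ g ∈ recCone B ∧
      ∀ i, dot (A i) g ≤ 0} := by
  obtain ⟨k, β, w, hβ, hrw⟩ := aux_decomp r
  let W : Fin k → E n := fun j => WithLp.toLp 2 (fun i => (w j i : ℝ))
  have hW : ∀ (c : Fin k → ℝ) i, (∑ j, c j • W j) i = ∑ j, c j * w j i := by
    intro c i
    simp [W]
  have hrW : r = ∑ j, β j • W j := by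
    ext i
    rw [hW, hrw]
  have hact : ∀ i, dot (A i) r = 0 → ∀ j, dot (A i) (W j) = 0 := by
    intro i hi
    choose q hq using hA i
    have h1 : ∀ j, dot (A i) (W j) = ((∑ l, q l * w j l : ℚ) : ℝ) := by
      intro j
      simp [dot, W, hq]
    rw [hrW, dot_comb] at hi
    have h2 := Fintype.linearIndependent_iff.1 hβ (fun j => ∑ l, q l * w j l) (by
      rw [← hi]
      refine Finset.sum_congr rfl fun j _ => ?_
      rw [h1, Rat.smul_def, mul_comm])
    intro j
    rw [h1, h2 j]; simp
  let V : Submodule ℝ (E n) := Submodule.span ℝ (Set.range W)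
  have hVmem : ∀ v ∈ V, ∃ θ : Fin k → ℝ, v = ∑ j, θ j • W j := by
    intro v hv
    obtain ⟨θ, hθ⟩ := (Submodule.mem_span_range_iff_exists_fun ℝ).1 hv
    exact ⟨θ, hθ.symm⟩
  have hcombV : ∀ θ : Fin k → ℝ, ∑ j, θ j • W j ∈ V := fun θ =>
    V.sum_mem fun j _ => V.smul_mem _ (Submodule.subset_span ⟨j, rfl⟩)
  have hV : ∀ v ∈ V, v ∈ recCone B := by
    apply aux_max hB hne V
    intro y hy v hv hyv
    obtain ⟨θ, rfl⟩ := hVmem v hv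
    obtain ⟨ε, hε, hball⟩ := Metric.isOpen_iff.1 isOpen_interior _ hyv
    obtain ⟨N, hN0, hN⟩ := aux_bound (fun i => dot (A i) r)
      (fun i => ∑ j, (|θ j| + 1) * |dot (A i) (W j)|)
      (fun i => Finset.sum_nonneg fun j _ => by positivity)
    have hsum0 : 0 ≤ ∑ j, ‖W j‖ := Finset.sum_nonneg fun j _ => norm_nonneg _
    obtain ⟨t, ht, p, hp⟩ := aux_kronecker β hβ θ (min 1 (ε / (∑ j, ‖W j‖ + 1))) N (by positivity)
    have ht0 : 0 ≤ t := hN0.trans ht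
    let e : Fin k → ℝ := fun j => p j - t * β j - θ j
    have he1 : ∀ j, |e j| < 1 := fun j => (hp j).trans_le (min_le_left _ _)
    have he2 : ∀ j, |e j| ≤ ε / (∑ j, ‖W j‖ + 1) := fun j => (hp j).le.trans (min_le_right _ _)
    have hpe : ∀ j, (p j : ℝ) = t * β j + (θ j + e j) := fun j => by simp only [e]; ring
    have hz : ∑ j, (p j : ℝ) • W j = (∑ j, θ j • W j + ∑ j, e j • W j) + t • r := by
      rw [hrW, Finset.smul_sum, ← Finset.sum_add_distrib, ← Finset.sum_add_distrib]
      refine Finset.sum_congr rfl fun j _ => ?_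
      rw [hpe]; module
    have hnorm : ‖∑ j, e j • W j‖ < ε := by
      have h1 : ‖∑ j, e j • W j‖ ≤ ∑ j, ε / (∑ j, ‖W j‖ + 1) * ‖W j‖ := by
        refine (norm_sum_le _ _).trans (Finset.sum_le_sum fun j _ => ?_)
        rw [norm_smul, Real.norm_eq_abs]
        exact mul_le_mul_of_nonneg_right (he2 j) (norm_nonneg _)
      refine h1.trans_lt ?_
      rw [← Finset.mul_sum, div_mul_eq_mul_div, div_lt_iff₀ (by positivity)]
      nlinarith
    have hin : y + ∑ j, (p j : ℝ) • W j ∈ interior B := by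
      have h1 := aux_int_rec hr (y + ∑ j, θ j • W j + ∑ j, e j • W j)
        (hball (by simpa [dist_eq_norm] using hnorm)) t ht0
      convert h1 using 1
      rw [hz]; abel
    refine hB.2.1 _ hin ⟨fun i => ?_, fun i => ?_⟩
    · obtain ⟨a, ha⟩ := hy.1 i
      refine ⟨a + ∑ j, p j * w j i, ?_⟩
      rw [PiLp.add_apply, hW, ha]
      push_cast; rfl
    · rw [dot_add']
      have h1 := hy.2 i
      have h2 : dot (A i) (∑ j, (p j : ℝ) • W j) ≤ 0 := by
        rcases (hAr i).lt_or_eq with hlt | heq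
        · have h3 := hN i hlt
          rw [hz, dot_add', dot_smul', ← Finset.sum_add_distrib]
          simp only [← add_smul]
          rw [dot_comb]
          have h4 : ∑ j, (θ j + e j) * dot (A i) (W j) ≤ ∑ j, (|θ j| + 1) * |dot (A i) (W j)| := by
            refine Finset.sum_le_sum fun j _ => ?_
            refine (le_abs_self _).trans ?_
            rw [abs_mul]
            refine mul_le_mul_of_nonneg_right ?_ (abs_nonneg _)
            exact (abs_add_le _ _).trans (by linarith [he1 j])
          have h5 := mul_le_mul_of_nonpos_right ht hlt.le
          linarith
        · rw [dot_comb]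
          refine (Finset.sum_eq_zero fun j _ => ?_).le
          rw [hact i heq j, mul_zero]
      linarith
  refine ⟨⟨hr, ?_⟩, ?_⟩
  · apply hV
    apply V.neg_mem
    rw [hrW]; exact hcombV β
  · obtain ⟨N, hN0, hN⟩ := aux_bound (fun i => dot (A i) r)
      (fun i => ∑ j, |dot (A i) (W j)|)
      (fun i => Finset.sum_nonneg fun j _ => by positivity)
    have hδ : 0 < 1 / (N + 1) := by positivity
    have hbox := aux_box β (1 / (N + 1)) hδ
    let T : (Fin k → ℝ) →ₗ[ℝ] E n := Fintype.linearCombination ℝ W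
    have hT : ∀ γ, T γ = ∑ j, γ j • W j := fun γ => by simp [T, Fintype.linearCombination_apply]
    have h1 : r ∈ T '' convexHull ℝ {γ : Fin k → ℝ | (∀ j, ∃ q : ℚ, γ j = q) ∧
        ∀ j, |γ j - β j| ≤ 1 / (N + 1)} := ⟨β, hbox, by rw [hT, hrW]⟩
    rw [LinearMap.image_convexHull] at h1
    refine convexHull_mono ?_ h1
    rintro _ ⟨γ, ⟨hγq, hγ⟩, rfl⟩
    rw [hT]
    refine ⟨fun i => ?_, hV _ (hcombV γ), fun i => ?_⟩
    · choose q hq using hγq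
      refine ⟨∑ j, q j * w j i, ?_⟩
      rw [hW]
      push_cast
      simp [hq]
    · rcases (hAr i).lt_or_eq with hlt | heq
      · have h3 := hN i hlt
        have h4 : dot (A i) (∑ j, γ j • W j)
            = dot (A i) r + ∑ j, (γ j - β j) * dot (A i) (W j) := by
          conv_rhs => rw [hrW]
          rw [dot_comb, dot_comb, ← Finset.sum_add_distrib]
          refine Finset.sum_congr rfl fun j _ => ?_
          ring
        have h5 : ∑ j, (γ j - β j) * dot (A i) (W j) ≤ 1 / (N + 1) * ∑ j, |dot (A i) (W j)| := by
          rw [Finset.mul_sum]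
          refine Finset.sum_le_sum fun j _ => ?_
          refine (le_abs_self _).trans ?_
          rw [abs_mul]
          exact mul_le_mul_of_nonneg_right (hγ j) (abs_nonneg _)
        have h6 : 1 / (N + 1) * ∑ j, |dot (A i) (W j)| ≤ 1 / (N + 1) * ((N + 1) * - dot (A i) r) :=
          mul_le_mul_of_nonneg_left (by linarith) hδ.le
        have h7 : 1 / (N + 1) * ((N + 1) * - dot (A i) r) = - dot (A i) r := by
          field_simp
        linarith
      · rw [dot_comb]
        refine (Finset.sum_eq_zero fun j _ => ?_).le
        rw [hact i heq j, mul_zero]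

/-- For a maximal S-free convex set B with int(B ∩ conv S) ≠ ∅, the recession
cone of B ∩ conv S is rational and contained in the lineality space of B. -/
theorem stmt_3 {n : ℕ} (S : Set (E n)) (hS : IsIntPtsOfRatPolyhedron S)
    (hdim : FullDimSet S) (B : Set (E n)) (hB : MaxSFree S B)
    (hne : (interior (B ∩ convexHull ℝ S)).Nonempty) :
    IsRationalCone (recCone (B ∩ convexHull ℝ S)) ∧
    recCone (B ∩ convexHull ℝ S) ⊆ linSpace B := by
  obtain ⟨m, A, b, hA, _, rfl⟩ := hS
  have hneB : (interior B).Nonempty := hne.mono (interior_mono Set.inter_subset_left)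
  have hcl := aux_closed hB hneB
  obtain ⟨x0, hx0⟩ := hne
  have hx0' := interior_subset hx0
  have hrecB : ∀ r ∈ recCone (B ∩ convexHull ℝ {x : E n | IsIntPt x ∧ ∀ i, dot (A i) x ≤ b i}),
      r ∈ recCone B := fun r hr => aux_rec hB.1 hcl x0 r fun t ht => (hr x0 hx0' t ht).1
  have hrecA : ∀ r ∈ recCone (B ∩ convexHull ℝ {x : E n | IsIntPt x ∧ ∀ i, dot (A i) x ≤ b i}),
      ∀ i, dot (A i) r ≤ 0 := by
    intro r hr i
    by_contra hpos
    push Not at hpos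
    have hsub : convexHull ℝ {x : E n | IsIntPt x ∧ ∀ i, dot (A i) x ≤ b i}
        ⊆ {x | dot (A i) x ≤ b i} := by
      refine convexHull_min (fun x hx => hx.2 i) ?_
      intro x hx y hy s t hs ht hst
      simp only [Set.mem_ofPred_eq] at hx hy ⊢
      rw [dot_add', dot_smul', dot_smul']
      have h1 := mul_le_mul_of_nonneg_left hx hs
      have h2 := mul_le_mul_of_nonneg_left hy ht
      have h3 : s * b i + t * b i = b i := by rw [← add_mul, hst, one_mul]
      linarith
    have h0 : dot (A i) x0 ≤ b i := hsub hx0'.2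
    have h1 : dot (A i) (x0 + ((b i - dot (A i) x0 + 1) / dot (A i) r) • r) ≤ b i :=
      hsub (hr x0 hx0' _ (div_nonneg (by linarith) hpos.le)).2
    rw [dot_add', dot_smul', div_mul_cancel₀ _ hpos.ne'] at h1
    linarith
  refine ⟨⟨{g | IsRatVec g ∧ g ∈ recCone (B ∩ convexHull ℝ
    {x : E n | IsIntPt x ∧ ∀ i, dot (A i) x ≤ b i})}, fun v hv => hv.1, ?_⟩, ?_⟩
  · apply Set.Subset.antisymm
    · intro r hr
      have h1 := (aux_core A b hA B hB hneB r (hrecB r hr) (hrecA r hr)).2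
      apply aux_hull
      refine convexHull_mono ?_ h1
      rintro g ⟨hg1, hg2, hg3⟩
      refine ⟨hg1, fun x hx t ht => ⟨hg2 x hx.1 t ht, ?_⟩⟩
      exact aux_conv_rec A b g hg1 hg3 x hx.2 t ht
    · exact aux_cone _ _ fun g hg => hg.2
  · intro r hr
    exact (aux_core A b hA B hB hneB r (hrecB r hr) (hrecA r hr)).1
end
end
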